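/- arXiv:1512.07293 — 7 statements merged into one kernel-verified Lean document; each statement's English description precedes it below -/
import Mathlib

section
/- In the BGPC problem with a subspace constraint: let n, m, N be positive integers with n > m, N·(n−m) ≥ n−1, and N ≤ m. Then for almost all triples (λ₀, X₀, A) ∈ ℂⁿ × ℂ^{m×N} × ℂ^{n×m}, the pair (λ₀, X₀) is identifiable up to scaling with constraint set Ω = ℂ^{m×N}; that is, every (λ₁, X₁) ∈ ℂⁿ × ℂ^{m×N} with diag(λ₁)·A·X₁ = diag(λ₀)·A·X₀ satisfies λ₁ = σ⁻¹·λ₀ and X₁ = σ·X₀ for some nonzero σ ∈ ℂ. -/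
open MeasureTheory Matrix

theorem ae_ne_zero_of_differentiable {E : Type*} [NormedAddCommGroup E] [NormedSpace ℂ E]
    [FiniteDimensional ℂ E] [MeasurableSpace E] [BorelSpace E] (μ : Measure E)
    [μ.IsAddHaarMeasure] {f : E → ℂ} (hf : Differentiable ℂ f) {x₀ : E} (h₀ : f x₀ ≠ 0) :
    ∀ᵐ x ∂μ, f x ≠ 0 := by
  have : FiniteDimensional ℝ E := FiniteDimensional.complexToReal E
  have : ProperSpace E := FiniteDimensional.proper ℂ E
  have hline (x : E) : ∀ᵐ s : ℝ, f (x₀ + (s : ℂ) • (x - x₀)) ≠ 0 := by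
    have hg : Differentiable ℂ fun s : ℂ => f (x₀ + s • (x - x₀)) := by fun_prop
    have hga : AnalyticOnNhd ℝ (fun s : ℝ => f (x₀ + (s : ℂ) • (x - x₀))) Set.univ := fun s _ =>
      ((hg.analyticAt (s : ℂ)).restrictScalars (𝕜 := ℝ)).comp (Complex.ofRealCLM.analyticAt s)
    have hcod := hga.preimage_zero_mem_codiscrete (x := 0) (by simpa using h₀)
    have := ae_restrict_le_codiscreteWithin (μ := volume) MeasurableSet.univ hcod
    rw [Measure.restrict_univ] at this
    exact this
  have hmeas : MeasurableSet {q : E × ℝ | f (x₀ + (q.2 : ℂ) • (q.1 - x₀)) ≠ 0} := by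
    have hc := hf.continuous
    refine (isOpen_ne_fun (?_ : Continuous _) continuous_const).measurableSet
    fun_prop
  have hcomm := (Measure.ae_ae_comm (μ := μ) (ν := (volume : Measure ℝ)) hmeas).1
    (Filter.Eventually.of_forall hline)
  obtain ⟨s, hs, hs0⟩ : ∃ s : ℝ, (∀ᵐ x ∂μ, f (x₀ + (s : ℂ) • (x - x₀)) ≠ 0) ∧ s ≠ 0 :=
    (hcomm.and (Measure.ae_ne volume 0)).exists
  rw [ae_iff] at hs ⊢
  have hset : {x | ¬ f (x₀ + (s : ℂ) • (x - x₀)) ≠ 0}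
      = (fun x => s • x) ⁻¹' ((fun y => (x₀ - s • x₀) + y) ⁻¹' {x | ¬ f x ≠ 0}) := by
    ext x
    have : x₀ + (s : ℂ) • (x - x₀) = x₀ - s • x₀ + s • x := by
      rw [Complex.coe_smul, smul_sub]; abel
    simp only [Set.mem_ofPred_eq, Set.mem_preimage, this]
  rw [hset, Measure.addHaar_preimage_smul μ hs0, measure_preimage_add] at hs
  simpa [hs0] using hs

theorem ae_injective_of_differentiable {E V W : Type*} [NormedAddCommGroup E] [NormedSpace ℂ E]
    [FiniteDimensional ℂ E] [MeasurableSpace E] [BorelSpace E] (μ : Measure E)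
    [μ.IsAddHaarMeasure] [AddCommGroup V] [Module ℂ V] [FiniteDimensional ℂ V]
    [NormedAddCommGroup W] [NormedSpace ℂ W] [FiniteDimensional ℂ W]
    {L : E → V →ₗ[ℂ] W} (hL : ∀ v, Differentiable ℂ fun t => L t v) {t₀ : E}
    (h₀ : Function.Injective (L t₀)) : ∀ᵐ t ∂μ, Function.Injective (L t) := by
  obtain ⟨B, hB⟩ := (L t₀).exists_leftInverse_of_injective (LinearMap.ker_eq_bot.2 h₀)
  let b := Module.finBasis ℂ V
  have hdiff : Differentiable ℂ fun t => (LinearMap.toMatrix b b (B ∘ₗ L t)).det := by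
    have hentry (i j) : Differentiable ℂ fun t => LinearMap.toMatrix b b (B ∘ₗ L t) i j := by
      have h : (fun t => LinearMap.toMatrix b b (B ∘ₗ L t) i j)
          = fun t => LinearMap.toContinuousLinearMap (b.coord i ∘ₗ B) (L t (b j)) := by
        ext t
        simp [LinearMap.toMatrix_apply]
      rw [h]
      exact (ContinuousLinearMap.differentiable _).comp (hL _)
    simp only [Matrix.det_apply]
    fun_prop
  have hne := ae_ne_zero_of_differentiable μ hdiff (x₀ := t₀) (by
    simp [hB])
  filter_upwards [hne] with t ht
  rw [LinearMap.det_toMatrix] at ht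
  have hinj := (LinearMap.equivOfDetNeZero _ ht).injective
  refine Function.Injective.of_comp (f := B) ?_
  exact hinj

theorem exists_submodule_finrank_eq_of_le {K V : Type*} [Field K] [AddCommGroup V] [Module K V]
    [FiniteDimensional K V] {p q : Submodule K V} (hpq : p ≤ q) {d : ℕ}
    (hp : Module.finrank K p ≤ d) (hq : d ≤ Module.finrank K q) :
    ∃ r : Submodule K V, p ≤ r ∧ r ≤ q ∧ Module.finrank K r = d := by
  induction d, hp using Nat.le_induction with
  | base => exact ⟨p, le_rfl, hpq, rfl⟩
  | succ d _ ih =>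
    obtain ⟨r, hpr, hrq, hr⟩ := ih (by omega)
    have hlt : r < q := lt_of_le_of_ne hrq (by rintro rfl; omega)
    obtain ⟨v, hvq, hvr⟩ := SetLike.exists_of_lt hlt
    refine ⟨r ⊔ K ∙ v, hpr.trans le_sup_left, sup_le hrq ?_, ?_⟩
    · simpa using hvq
    · rw [Submodule.finrank_sup_span_singleton hvr, hr]

theorem exists_rectangular_partition {N r k : ℕ} (hk : 0 < k) (hkN : k ≤ N * r) :
    ∃ (g : Fin N → Fin r → Fin k) (P : Fin k → Fin N → Prop) (Q : Fin k → Fin r → Prop),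
      (∀ l, ∃ a b, g a b = l) ∧ ∀ l a b, g a b = l ↔ P l a ∧ Q l b := by
  have hr : 0 < r := Nat.pos_of_ne_zero (by rintro rfl; omega)
  set A := (k - 1) / r with hA
  set B := (k - 1) % r with hB
  have hBr : B < r := Nat.mod_lt _ hr
  have hAB : r * A + B + 1 = k := by rw [hA, hB, Nat.div_add_mod]; omega
  have hAN : A < N := by
    rw [hA, Nat.div_lt_iff_lt_mul hr]; omega
  let row (a : ℕ) := min a A
  let col (c b : ℕ) := if c < A then b else min b B
  have hcol {c b : ℕ} (hb : b < r) : col c b < r := by simp only [col]; split_ifs <;> omega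
  have hlt {a b : ℕ} (hb : b < r) : r * row a + col (row a) b < k := by
    simp only [row, col]
    split_ifs with h
    · have : r * (min a A + 1) ≤ r * A := Nat.mul_le_mul_left _ h
      rw [mul_add] at this; omega
    · have : min a A = A := by omega
      rw [this]; omega
  refine ⟨fun a b => ⟨r * row a + col (row a) b, hlt b.2⟩, fun l a => row a = l / r,
    fun l b => col (l / r) b = l % r, fun l => ?_, fun l a b => ?_⟩
  · have h1 : (l : ℕ) / r ≤ A := Nat.div_le_div_right (by omega)
    have h2 := Nat.mod_lt (l : ℕ) hr
    have h3 := Nat.div_add_mod (l : ℕ) r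
    refine ⟨⟨l / r, by omega⟩, ⟨l % r, h2⟩, Fin.ext ?_⟩
    have hrow : row (l / r) = l / r := min_eq_left h1
    have hc : col (l / r) (l % r) = l % r := by
      simp only [col]
      split_ifs with h
      · rfl
      · have : (l : ℕ) / r = A := by omega
        rw [this] at h3
        omega
    simp only [hrow, hc, h3]
  · rw [Fin.ext_iff]
    simp only
    constructor
    · intro h
      have hd : row a = l / r := by
        rw [← h, Nat.mul_add_div hr, Nat.div_eq_of_lt (hcol b.2), add_zero]
      refine ⟨hd, ?_⟩
      rw [← hd, ← h, Nat.mul_add_mod, Nat.mod_eq_of_lt (hcol b.2)]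
    · rintro ⟨h1, h2⟩
      rw [h1, h2, Nat.div_add_mod]

theorem exists_orthogonal_families {n N r : ℕ} (hn : 1 < n) (hnr : n - 1 ≤ N * r) :
    ∃ (p : Fin n → Fin N → ℂ) (q : Fin n → Fin r → ℂ), (∀ a b, ∑ i, p i a * q i b = 0) ∧
      ∀ c : Fin n → ℂ, (∀ a b, ∑ i, c i * p i a * q i b = 0) → ∀ i j, c i = c j := by
  classical
  obtain ⟨k, rfl⟩ : ∃ k, n = k + 1 := ⟨n - 1, by omega⟩
  obtain ⟨g, P, Q, hsurj, hg⟩ := exists_rectangular_partition (N := N) (r := r) (k := k)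
    (by omega) (by simpa using hnr)
  have hsum (c : Fin (k + 1) → ℂ) (a : Fin N) (b : Fin r) :
      ∑ i, c i * (Fin.cons 1 (fun l a => if P l a then 1 else 0) : Fin (k + 1) → Fin N → ℂ) i a *
        (Fin.cons (-1) (fun l b => if Q l b then 1 else 0) : Fin (k + 1) → Fin r → ℂ) i b
        = c (g a b).succ - c 0 := by
    rw [Fin.sum_univ_succ]
    have (l : Fin k) : c l.succ * (if P l a then 1 else 0) * (if Q l b then 1 else 0)
        = if g a b = l then c l.succ else 0 := by
      simp only [hg]
      split_ifs <;> simp_all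
    simp only [Fin.cons_zero, Fin.cons_succ, this, Pi.one_apply, Pi.neg_apply]
    rw [Finset.sum_ite_eq, if_pos (Finset.mem_univ _)]
    ring
  refine ⟨_, _, fun a b => by simpa using hsum 1 a b, fun c hc => ?_⟩
  have h0 (i) : c i = c 0 := by
    induction i using Fin.cases with
    | zero => rfl
    | succ l =>
      obtain ⟨a, b, rfl⟩ := hsurj l
      exact sub_eq_zero.1 ((hsum c a b).symm.trans (hc a b))
  exact fun i j => (h0 i).trans (h0 j).symm


/-- The linearization `(γ, X) ↦ (γ i₀, diag(γ) A X₀ - A X)` of the identifiability problem for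
`t = (λ₀, X₀, A)`. -/
def gainMap {n m N : ℕ} (i₀ : Fin n)
    (t : (Fin n → ℂ) × (Fin m → Fin N → ℂ) × (Fin n → Fin m → ℂ)) :
    (Fin n → ℂ) × (Fin m → Fin N → ℂ) →ₗ[ℂ] ℂ × (Fin n → Fin N → ℂ) where
  toFun v := (v.1 i₀, fun i k => v.1 i * ∑ j, t.2.2 i j * t.2.1 j k - ∑ j, t.2.2 i j * v.2 j k)
  map_add' v w := by
    ext <;> simp [mul_add, add_mul, Finset.sum_add_distrib]; ring
  map_smul' c v := by
    ext
    · simp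
    · simp only [Prod.smul_fst, Prod.smul_snd, Pi.smul_apply, smul_eq_mul, RingHom.id_apply,
        mul_sub, Finset.mul_sum]
      congr 1 <;> exact Finset.sum_congr rfl fun _ _ => by ring

theorem exists_injective_gainMap {n m N : ℕ} (i₀ : Fin n) (hm : 0 < m) (hmn : m < n)
    (hsc : n - 1 ≤ N * (n - m)) (hNm : N ≤ m) :
    ∃ t : (Fin n → ℂ) × (Fin m → Fin N → ℂ) × (Fin n → Fin m → ℂ),
      Function.Injective (gainMap i₀ t) := by
  obtain ⟨p, q, hpq, hc⟩ := exists_orthogonal_families (n := n) (by omega) hsc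
  let Φ : (Fin n → ℂ) →ₗ[ℂ] (Fin (n - m) → ℂ) := Matrix.mulVecLin (Matrix.of fun b i => q i b)
  have hΦ (v b) : Φ v b = ∑ i, v i * q i b := by
    simp [Φ, Matrix.mulVec, dotProduct, mul_comm]
  obtain ⟨S, hpS, hSΦ, hS⟩ := exists_submodule_finrank_eq_of_le (K := ℂ) (d := m)
      (p := Submodule.span ℂ (Set.range fun a i => p i a)) (q := LinearMap.ker Φ)
    (by
      rw [Submodule.span_le]
      rintro _ ⟨a, rfl⟩
      exact LinearMap.mem_ker.2 (funext fun b => (hΦ _ b).trans (hpq a b)))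
    ((finrank_range_le_card (R := ℂ) fun a i => p i a).trans (by simpa using hNm))
    (by
      have h1 := LinearMap.finrank_range_add_finrank_ker Φ
      have h2 := Submodule.finrank_le (LinearMap.range Φ)
      simp only [Module.finrank_fin_fun] at h1 h2
      omega)
  let b : Module.Basis (Fin m) ℂ S := Module.finBasisOfFinrankEq ℂ S hS
  have hpmem (a) : (fun i => p i a) ∈ S := hpS (Submodule.subset_span ⟨a, rfl⟩)
  have hrepr (a i) : ∑ j, (b j : Fin n → ℂ) i * b.repr ⟨_, hpmem a⟩ j = p i a := by
    have h := congrArg (fun v : S => (v : Fin n → ℂ) i) (b.sum_repr ⟨_, hpmem a⟩)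
    simpa only [Submodule.coe_sum, Finset.sum_apply, Submodule.coe_smul, Pi.smul_apply,
      smul_eq_mul, mul_comm] using h
  refine ⟨(0, fun j a => b.repr ⟨_, hpmem a⟩ j, fun i j => (b j : Fin n → ℂ) i), ?_⟩
  rw [← LinearMap.ker_eq_bot, LinearMap.ker_eq_bot']
  rintro ⟨γ, X⟩ h
  obtain ⟨hγ₀, hX⟩ := Prod.ext_iff.1 h
  have hX' (i k) : γ i * p i k = ∑ j, (b j : Fin n → ℂ) i * X j k := by
    have := congrFun (congrFun hX i) k
    simp only [gainMap, LinearMap.coe_mk, AddHom.coe_mk, hrepr] at this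
    exact sub_eq_zero.1 this
  have hcomb (k i) : ((∑ j, X j k • b j : S) : Fin n → ℂ) i = γ i * p i k := by
    simp [hX', Finset.sum_apply, mul_comm]
  have hγ : γ = 0 := by
    ext i
    refine (hc γ (fun a c => ?_) i i₀).trans hγ₀
    have h1 : Φ (∑ j, X j a • b j : S) = 0 := hSΦ (Submodule.coe_mem _)
    have h2 := congrFun h1 c
    rw [hΦ] at h2
    simpa only [hcomb, Pi.zero_apply] using h2
  refine Prod.ext hγ ?_
  ext j k
  have h0 : (∑ j, X j k • b j : S) = 0 := by
    ext i
    rw [hcomb, hγ]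
    simp
  exact Fintype.linearIndependent_iff.1 b.linearIndependent _ h0 j

/-- BGPC with a subspace constraint: if `n > m` and `(n-1)/(n-m) ≤ N ≤ m`, then for almost all
`(λ₀, X₀, A)`, the pair `(λ₀, X₀)` is identifiable up to scaling. -/
theorem stmt0 {n m N : ℕ} (hn : 0 < n) (hm : 0 < m) (hN : 0 < N)
    (hmn : m < n) (hsc : n - 1 ≤ N * (n - m)) (hNm : N ≤ m) :
    ∀ᵐ t : (Fin n → ℂ) × (Fin m → Fin N → ℂ) × (Fin n → Fin m → ℂ) ∂volume,
      ∀ (lam1 : Fin n → ℂ) (X1 : Matrix (Fin m) (Fin N) ℂ),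
        Matrix.diagonal lam1 * Matrix.of t.2.2 * X1
          = Matrix.diagonal t.1 * Matrix.of t.2.2 * Matrix.of t.2.1 →
        ∃ σ : ℂ, σ ≠ 0 ∧ lam1 = σ⁻¹ • t.1 ∧ X1 = σ • Matrix.of t.2.1 := by
  have i₀ : Fin n := ⟨0, hn⟩
  have k₀ : Fin N := ⟨0, hN⟩
  have hpi (a b : ℕ) : (volume : Measure (Fin a → Fin b → ℂ)).IsAddHaarMeasure :=
    Measure.pi.isAddHaarMeasure fun _ => volume
  have hvol : (volume : Measure ((Fin n → ℂ) × (Fin m → Fin N → ℂ) ×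
      (Fin n → Fin m → ℂ))).IsAddHaarMeasure :=
    have := Measure.prod.instIsAddHaarMeasure (volume : Measure (Fin m → Fin N → ℂ))
      (volume : Measure (Fin n → Fin m → ℂ))
    Measure.prod.instIsAddHaarMeasure volume (volume.prod volume)
  obtain ⟨t₀, ht₀⟩ := exists_injective_gainMap i₀ hm hmn hsc hNm
  have hinj := ae_injective_of_differentiable volume
    (L := gainMap i₀) (fun v => by
      simp only [gainMap, LinearMap.coe_mk, AddHom.coe_mk]
      fun_prop) ht₀
  have hlam : ∀ᵐ t : (Fin n → ℂ) × (Fin m → Fin N → ℂ) × (Fin n → Fin m → ℂ),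
      ∀ i, t.1 i ≠ 0 := ae_all_iff.2 fun i =>
    ae_ne_zero_of_differentiable volume (x₀ := 1)
      (f := fun t : (Fin n → ℂ) × (Fin m → Fin N → ℂ) × (Fin n → Fin m → ℂ) => t.1 i) (by fun_prop) (by simp)
  have hrow : ∀ᵐ t : (Fin n → ℂ) × (Fin m → Fin N → ℂ) × (Fin n → Fin m → ℂ),
      ∀ i, ∑ j, t.2.2 i j * t.2.1 j k₀ ≠ 0 := ae_all_iff.2 fun i =>
    ae_ne_zero_of_differentiable volume (x₀ := 1)
      (f := fun t : (Fin n → ℂ) × (Fin m → Fin N → ℂ) × (Fin n → Fin m → ℂ) =>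
        ∑ j, t.2.2 i j * t.2.1 j k₀)
      (by fun_prop) (by simp [hm.ne'])
  filter_upwards [hinj, hlam, hrow] with t hinj hlam hrow lam1 X1 heq
  have hentry (i k) : lam1 i * ∑ j, t.2.2 i j * X1 j k
      = t.1 i * ∑ j, t.2.2 i j * t.2.1 j k := by
    have := congrFun (congrFun heq i) k
    rw [Matrix.mul_assoc, Matrix.mul_assoc, Matrix.diagonal_mul, Matrix.diagonal_mul] at this
    exact this
  have hlam1 (i) : lam1 i ≠ 0 := by
    intro h
    have := hentry i k₀
    rw [h, zero_mul] at this
    exact mul_ne_zero (hlam i) (hrow i) this.symm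
  set σ : ℂ := t.1 i₀ / lam1 i₀ with hσ
  have hσ0 : σ ≠ 0 := div_ne_zero (hlam i₀) (hlam1 i₀)
  have hmap : gainMap i₀ t (fun i => t.1 i / lam1 i, X1) = gainMap i₀ t (σ • 1, σ • t.2.1) := by
    refine Prod.ext (by simp [gainMap, hσ]) ?_
    ext i k
    have h1 : t.1 i / lam1 i * ∑ j, t.2.2 i j * t.2.1 j k = ∑ j, t.2.2 i j * X1 j k := by
      rw [div_mul_eq_mul_div, div_eq_iff (hlam1 i), ← hentry, mul_comm]
    simp only [gainMap, LinearMap.coe_mk, AddHom.coe_mk, h1]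
    simp [Finset.mul_sum, mul_left_comm]
  obtain ⟨h1, h2⟩ := Prod.ext_iff.1 (hinj hmap)
  refine ⟨σ, hσ0, ?_, h2⟩
  ext i
  have h := congrFun h1 i
  simp only [Pi.smul_apply, Pi.one_apply, smul_eq_mul, mul_one] at h ⊢
  rw [← h, inv_div, div_mul_cancel₀ _ (hlam i)]
end

section
/- In the BGPC problem with a joint sparsity constraint: let n, m, N, s be positive integers with n > 2s, N·(n−2s) ≥ n−1, and N ≤ s ≤ m. Fix J₀ ⊆ {1,…,m} with |J₀| = s. Then for almost all triples (λ₀, A, Z) ∈ ℂⁿ × ℂ^{n×m} × ℂ^{s×N}, letting X₀ ∈ ℂ^{m×N} be the matrix whose rows indexed by J₀ (in increasing order) are the rows of Z and whose remaining rows are zero, the pair (λ₀, X₀) is identifiable up to scaling with constraint set Ω_s = {X ∈ ℂ^{m×N} : X has at most s nonzero rows}. -/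
open MeasureTheory Matrix

noncomputable section

/-- `X` has at most `s` nonzero rows. -/
def JointSparse {m N : ℕ} (s : ℕ) (X : Matrix (Fin m) (Fin N) ℂ) : Prop :=
  {i : Fin m | X i ≠ 0}.ncard ≤ s

/-- The `m × N` matrix whose rows indexed by `J0` (in increasing order) are the rows of `Z`,
and whose remaining rows are zero. -/
def embedRows {m s N : ℕ} (J0 : Finset (Fin m)) (h : J0.card = s)
    (Z : Matrix (Fin s) (Fin N) ℂ) : Matrix (Fin m) (Fin N) ℂ :=
  Matrix.of fun i j =>
    if hi : i ∈ J0 then Z ((J0.orderIsoOfFin h).symm ⟨i, hi⟩) j else 0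

open Pointwise in
theorem ae_ne_zero_of_contDiff_omega {E : Type*} [NormedAddCommGroup E] [NormedSpace ℝ E]
    [FiniteDimensional ℝ E] [MeasurableSpace E] [BorelSpace E] (μ : Measure E)
    [μ.IsAddHaarMeasure] {f : E → ℂ} (hf : ContDiff ℝ ⊤ f) {b : E} (hb : f b ≠ 0) :
    ∀ᵐ x ∂μ, f x ≠ 0 := by
  have hfc : Continuous f := hf.continuous
  have hline (y : E) : ∀ᵐ r : ℝ, f (b + r • y) ≠ 0 := by
    have han : AnalyticOnNhd ℝ (fun r : ℝ => f (b + r • y)) Set.univ := by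
      refine contDiff_omega_iff_analyticOnNhd.1 (ContDiff.comp hf ?_)
      fun_prop
    have hmem := han.preimage_zero_mem_codiscrete (x := 0) (by simpa using hb)
    have hle := ae_restrict_le_codiscreteWithin (μ := (volume : Measure ℝ))
      (U := (Set.univ : Set ℝ)) MeasurableSet.univ
    rw [Measure.restrict_univ] at hle
    exact hle hmem
  have hmeas : MeasurableSet {p : E × ℝ | f (b + p.2 • p.1) ≠ 0} :=
    (isOpen_ne_fun (by fun_prop) continuous_const).measurableSet
  have hswap : ∀ᵐ r : ℝ, ∀ᵐ y ∂μ, f (b + r • y) ≠ 0 := (Measure.ae_ae_comm hmeas).1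
    (Filter.Eventually.of_forall hline)
  obtain ⟨r, hr, hr0⟩ := (hswap.and (Measure.ae_ne (volume : Measure ℝ) 0)).exists
  have hr' : μ {y | ¬ f (b + r • y) ≠ 0} = 0 := hr
  have hset : {x | ¬ f x ≠ 0} = (fun x => -b + x) ⁻¹' (r • {y | ¬ f (b + r • y) ≠ 0}) := by
    ext x
    simp [Set.mem_smul_set_iff_inv_smul_mem₀ hr0, smul_smul, hr0]
  rw [ae_iff, hset, measure_preimage_add, Measure.addHaar_smul, hr', mul_zero]

theorem ae_injective_of_exists_injective {E : Type*} [NormedAddCommGroup E] [NormedSpace ℝ E]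
    [FiniteDimensional ℝ E] [MeasurableSpace E] [BorelSpace E] (μ : Measure E)
    [μ.IsAddHaarMeasure] {U ι : Type*} [AddCommGroup U] [Module ℂ U] [FiniteDimensional ℂ U]
    [Fintype ι] (T : E → U →ₗ[ℂ] (ι → ℂ)) (hT : ∀ u i, ContDiff ℝ ⊤ fun x => T x u i)
    (hinj : ∃ x, Function.Injective (T x)) :
    ∀ᵐ x ∂μ, Function.Injective (T x) := by
  classical
  obtain ⟨x₀, hx₀⟩ := hinj
  obtain ⟨L, hL⟩ := (T x₀).exists_leftInverse_of_injective (LinearMap.ker_eq_bot.2 hx₀)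
  let b := Module.finBasis ℂ U
  have hcoord (φ : (ι → ℂ) →ₗ[ℂ] ℂ) (u : U) : ContDiff ℝ ⊤ fun x => φ (T x u) := by
    have hφ (x : E) : φ (T x u) = ∑ i, T x u i * φ (Pi.single i 1) := by
      conv_lhs => rw [pi_eq_sum_univ' (T x u)]
      simp [map_sum]
    simp_rw [hφ]
    exact ContDiff.sum fun i _ => (hT u i).mul contDiff_const
  have hdet : ContDiff ℝ ⊤ fun x => (LinearMap.toMatrix b b (L ∘ₗ T x)).det := by
    simp_rw [Matrix.det_apply]
    refine ContDiff.sum fun σ _ => ContDiff.const_smul _ (contDiff_prod fun i _ => ?_)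
    simp_rw [LinearMap.toMatrix_apply]
    exact hcoord (b.coord (σ i) ∘ₗ L) (b i)
  filter_upwards [ae_ne_zero_of_contDiff_omega μ hdet (b := x₀) (by simp [hL])] with x hx
  rw [LinearMap.det_toMatrix] at hx
  have hker : LinearMap.ker (L ∘ₗ T x) = ⊥ :=
    not_not.1 (mt LinearMap.det_eq_zero_iff_ker_ne_bot.2 hx)
  exact Function.Injective.of_comp (f := L) (LinearMap.ker_eq_bot.1 hker)

theorem exists_rankOne_family {n q N : ℕ} (hq : 0 < q) (hN : 0 < N) (hle : N + q ≤ n)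
    (hcard : n - 1 ≤ q * N) :
    ∃ (B : Fin n → Fin q → ℂ) (y : Fin n → Fin N → ℂ),
      (∀ i j, ∑ l, B l i * y l j = 0) ∧
      (∀ γ : Fin n → ℂ, (∀ i j, ∑ l, B l i * (γ l * y l j) = 0) → ∀ l l', γ l = γ l') ∧
      LinearIndependent ℂ fun j l => y l j := by
  classical
  let i₀ : Fin q := ⟨0, hq⟩
  let j₀ : Fin N := ⟨0, hN⟩
  let cross : Finset (Fin q × Fin N) :=
    Finset.univ.image (fun j => (i₀, j)) ∪ ({i₀}ᶜ : Finset (Fin q)).image fun i => (i, j₀)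
  have hcross : cross.card ≤ n - 1 := by
    refine (Finset.card_union_le _ _).trans ?_
    refine (Nat.add_le_add Finset.card_image_le Finset.card_image_le).trans ?_
    simp [Finset.card_compl]
    omega
  obtain ⟨S, hcS, -, hS⟩ := Finset.exists_subsuperset_card_eq (Finset.subset_univ cross) hcross
    (by simpa using hcard)
  have hrow (j : Fin N) : (i₀, j) ∈ S := hcS (by simp [cross])
  have hcol (i : Fin q) : (i, j₀) ∈ S := by
    by_cases hi : i = i₀
    · exact hi ▸ hrow j₀
    · exact hcS (by simp [cross, Ne.symm hi, hi])
  let ρ : Fin q → Fin N → S := fun i j =>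
    if h : (i, j) ∈ S then ⟨(i, j), h⟩ else ⟨(i, j₀), hcol i⟩
  have hρ_fst (i : Fin q) (j : Fin N) : (ρ i j).1.1 = i := by
    by_cases h : (i, j) ∈ S <;> simp [ρ, h]
  have hρ_mem (x : S) : ρ x.1.1 x.1.2 = x := by simp [ρ]
  let e : Fin n ≃ Option S := Fintype.equivOfCardEq (by simp [hS]; omega)
  let B' : Option S → Fin q → ℂ := fun o i => o.elim (-1) fun x => if x.1.1 = i then 1 else 0
  let y' : Option S → Fin N → ℂ := fun o j => o.elim 1 fun x => if ρ x.1.1 j = x then 1 else 0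
  have hsum (γ : Option S → ℂ) (i : Fin q) (j : Fin N) :
      ∑ o, B' o i * (γ o * y' o j) = γ (some (ρ i j)) - γ none := by
    have hterm (x : S) : B' (some x) i * (γ (some x) * y' (some x) j)
        = if x = ρ i j then γ (some x) else 0 := by
      by_cases h : x.1.1 = i
      · subst h
        simp [B', y', eq_comm]
      · have : x ≠ ρ i j := fun hx => h (hx ▸ hρ_fst i j)
        simp [B', h, this]
    rw [Fintype.sum_option]
    simp_rw [hterm]
    simp [B', y']
    ring
  refine ⟨fun l => B' (e l), fun l => y' (e l), fun i j => ?_, fun γ hγ => ?_, ?_⟩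
  · rw [Equiv.sum_comp e fun o => B' o i * y' o j]
    simpa using hsum (fun _ => 1) i j
  · have hnone (o : Option S) : γ (e.symm o) = γ (e.symm none) := by
      cases o with
      | none => rfl
      | some x =>
        have h := hsum (γ ∘ e.symm) x.1.1 x.1.2
        rw [← Equiv.sum_comp e] at h
        simp only [Function.comp_apply, Equiv.symm_apply_apply, hγ, hρ_mem] at h
        exact sub_eq_zero.1 h.symm
    intro l l'
    simpa using (hnone (e l)).trans (hnone (e l')).symm
  · refine Fintype.linearIndependent_iff.2 fun c hc j => ?_
    have h := congrFun hc (e.symm (some ⟨(i₀, j), hrow j⟩))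
    have hy (j' : Fin N) : ρ i₀ j' = ⟨(i₀, j'), hrow j'⟩ := by simp [ρ, hrow]
    simpa [y', hy] using h

theorem exists_linearIndependent_extend {V κ ν : Type*} [AddCommGroup V] [Module ℂ V]
    [FiniteDimensional ℂ V] [Fintype κ] [Fintype ν] {v : ν → V} (hv : LinearIndependent ℂ v)
    {e : ν → κ} (he : Function.Injective e) (hcard : Fintype.card κ ≤ Module.finrank ℂ V) :
    ∃ a : κ → V, LinearIndependent ℂ a ∧ ∀ j, a (e j) = v j := by
  classical
  let b := Module.Basis.sumExtend hv
  have : Fintype (ν ⊕ Module.Basis.sumExtendIndex hv) := FiniteDimensional.fintypeBasisIndex b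
  have hb (j : ν) : b (Sum.inl j) = v j := by
    simp [b, Module.Basis.sumExtend]
    erw [Equiv.Set.sumDiffSubset_apply_inl (hv.linearIndepOn_id.subset_extend _)]
    simp
  have hcb : Fintype.card κ ≤ Fintype.card (ν ⊕ Module.Basis.sumExtendIndex hv) := by
    rwa [← Module.finrank_eq_card_basis b]
  obtain ⟨t, ht, -, htc⟩ := Finset.exists_subsuperset_card_eq
    (Finset.subset_univ (Finset.univ.image (Sum.inl : ν → ν ⊕ Module.Basis.sumExtendIndex hv)))
    (n := Fintype.card κ)
    (by
      rw [Finset.card_image_of_injective _ Sum.inl_injective]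
      exact Fintype.card_le_of_injective e he) (by simpa using hcb)
  by_cases hν : Nonempty ν
  · let f : κ → ν ⊕ Module.Basis.sumExtendIndex hv := fun k => Sum.inl (Function.invFun e k)
    have hfe (j : ν) : f (e j) = Sum.inl j := by
      simp [f, Function.leftInverse_invFun he j]
    obtain ⟨g, hg⟩ := Finset.exists_equiv_extend_of_card_eq (α := κ) (t := t) htc.symm
      (s := Finset.univ.image e) (f := f) (by
        refine subset_trans ?_ ht
        intro x hx
        simp only [Finset.mem_image, Finset.mem_univ, true_and] at hx ⊢
        obtain ⟨k, -, rfl⟩ := hx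
        exact ⟨_, rfl⟩) (by
        intro x hx y hy hxy
        simp only [Finset.coe_image, Finset.coe_univ, Set.image_univ, Set.mem_range] at hx hy
        obtain ⟨j, rfl⟩ := hx
        obtain ⟨j', rfl⟩ := hy
        rw [hfe, hfe] at hxy
        rw [Sum.inl_injective hxy])
    refine ⟨fun k => b (g k), b.linearIndependent.comp _
      (Subtype.val_injective.comp g.injective), fun j => ?_⟩
    simp only
    rw [hg (e j) (by simp), hfe, hb]
  · let g : κ ≃ t := Fintype.equivOfCardEq (by simp [htc])
    exact ⟨fun k => b (g k), b.linearIndependent.comp _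
      (Subtype.val_injective.comp g.injective), fun j => (hν ⟨j⟩).elim⟩

/-- The linear system whose kernel consists of the pairs `(γ, W)` with `γ l₀ = 0` and
`A_K * W = diagonal γ * A * X₀`, where `A_K` is formed by the columns of `A` in `K`. -/
def calibrationMap {n m N s : ℕ} (J0 : Finset (Fin m)) (hJ0 : J0.card = s) (K : Finset (Fin m))
    (l₀ : Fin n) (t : (Fin n → ℂ) × (Fin n → Fin m → ℂ) × (Fin s → Fin N → ℂ)) :
    ((Fin n → ℂ) × (K → Fin N → ℂ)) →ₗ[ℂ] (Option (Fin n × Fin N) → ℂ) where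
  toFun u o := o.elim (u.1 l₀) fun p => ∑ k : K, t.2.1 p.1 k * u.2 k p.2
    - u.1 p.1 * ∑ i, t.2.1 p.1 i * embedRows J0 hJ0 (Matrix.of t.2.2) i p.2
  map_add' u v := by
    funext o
    cases o with
    | none => simp
    | some p =>
      simp [mul_add, add_mul, Finset.sum_add_distrib]
      ring
  map_smul' c u := by
    funext o
    cases o with
    | none => simp
    | some p => simp [mul_sub, Finset.mul_sum, mul_assoc, mul_left_comm]

theorem contDiff_calibrationMap {n m N s : ℕ} (J0 : Finset (Fin m)) (hJ0 : J0.card = s)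
    (K : Finset (Fin m)) (l₀ : Fin n) (u : (Fin n → ℂ) × (K → Fin N → ℂ))
    (o : Option (Fin n × Fin N)) :
    ContDiff ℝ ⊤ fun t => calibrationMap J0 hJ0 K l₀ t u o := by
  cases o with
  | none => exact contDiff_const
  | some p =>
    have hA (i : Fin m) : ContDiff ℝ ⊤
        fun t : (Fin n → ℂ) × (Fin n → Fin m → ℂ) × (Fin s → Fin N → ℂ) => t.2.1 p.1 i := by
      fun_prop
    have hX (i : Fin m) : ContDiff ℝ ⊤
        fun t : (Fin n → ℂ) × (Fin n → Fin m → ℂ) × (Fin s → Fin N → ℂ) =>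
          embedRows J0 hJ0 (Matrix.of t.2.2) i p.2 := by
      by_cases hi : i ∈ J0
      · simp only [embedRows, Matrix.of_apply, hi, dite_true]
        fun_prop
      · simp only [embedRows, Matrix.of_apply, hi, dite_false]
        exact contDiff_const
    change ContDiff ℝ ⊤ fun t : (Fin n → ℂ) × (Fin n → Fin m → ℂ) × (Fin s → Fin N → ℂ) =>
      ∑ k : K, t.2.1 p.1 k * u.2 k p.2
        - u.1 p.1 * ∑ i, t.2.1 p.1 i * embedRows J0 hJ0 (Matrix.of t.2.2) i p.2
    refine ContDiff.sub (ContDiff.sum fun k _ => ?_)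
      (contDiff_const.mul (ContDiff.sum fun i _ => (hA i).mul (hX i)))
    exact (hA k).mul contDiff_const

theorem exists_injective_calibrationMap {n m N s : ℕ} (hN : 0 < N) (hNs : N ≤ s)
    (J0 : Finset (Fin m)) (hJ0 : J0.card = s) (K : Finset (Fin m)) (hJK : J0 ⊆ K)
    (hKn : K.card < n) (hcard : n - 1 ≤ (n - K.card) * N) (l₀ : Fin n) :
    ∃ t : (Fin n → ℂ) × (Fin n → Fin m → ℂ) × (Fin s → Fin N → ℂ),
      Function.Injective (calibrationMap J0 hJ0 K l₀ t) := by
  classical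
  have hsK : s ≤ K.card := hJ0 ▸ Finset.card_le_card hJK
  obtain ⟨B, y, hBy, hγ, hy⟩ := exists_rankOne_family (n := n) (q := n - K.card) (N := N)
    (by omega) hN (by omega) hcard
  let V := LinearMap.ker (Matrix.mulVecLin (Matrix.of fun i l => B l i))
  have hV (x : Fin n → ℂ) : x ∈ V ↔ ∀ i, ∑ l, B l i * x l = 0 := by
    simp [V, funext_iff, Matrix.mulVec, dotProduct]
  have hVdim : K.card ≤ Module.finrank ℂ V := by
    have h := LinearMap.finrank_range_add_finrank_ker
      (Matrix.mulVecLin (Matrix.of fun i l => B l i))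
    have h' := Submodule.finrank_le
      (LinearMap.range (Matrix.mulVecLin (Matrix.of fun i l => B l i)))
    simp only [Module.finrank_fin_fun] at h h'
    change _ + Module.finrank ℂ V = n at h
    omega
  let v : Fin N → V := fun j => ⟨fun l => y l j, (hV _).2 fun i => hBy i j⟩
  have hv : LinearIndependent ℂ v := LinearIndependent.of_comp V.subtype hy
  let e : Fin N → K := fun j => ⟨J0.orderIsoOfFin hJ0 (Fin.castLE hNs j), hJK (Subtype.prop _)⟩
  have he : Function.Injective e := by
    intro j j' h
    have h' := congrArg Subtype.val h
    simpa [e] using h'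
  obtain ⟨a, ha, hae⟩ := exists_linearIndependent_extend hv he (by simpa using hVdim)
  let A : Fin n → Fin m → ℂ := fun l i => if hi : i ∈ K then (a ⟨i, hi⟩ : Fin n → ℂ) l else 0
  let Z : Fin s → Fin N → ℂ := fun i j => if i = Fin.castLE hNs j then 1 else 0
  have hAK (l : Fin n) (k : K) : A l k = (a k : Fin n → ℂ) l := by simp [A]
  have hX (i : Fin m) (j : Fin N) :
      embedRows J0 hJ0 (Matrix.of Z) i j = if i = e j then 1 else 0 := by
    by_cases hi : i ∈ J0
    · simp only [embedRows, Matrix.of_apply, hi, dite_true, Z, e, OrderIso.symm_apply_eq,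
        Subtype.ext_iff]
    · have : i ≠ e j := fun h => hi (h ▸ Subtype.prop (J0.orderIsoOfFin hJ0 (Fin.castLE hNs j)))
      simp [embedRows, hi, this]
  have hAX (l : Fin n) (j : Fin N) :
      ∑ i, A l i * embedRows J0 hJ0 (Matrix.of Z) i j = y l j := by
    simp_rw [hX]
    simp [hAK, hae, v]
  refine ⟨(0, A, Z), (injective_iff_map_eq_zero _).2 fun ⟨γ, W⟩ hu => ?_⟩
  have hγ₀ : γ l₀ = 0 := congrFun hu none
  have heq (l : Fin n) (j : Fin N) : ∑ k : K, (a k : Fin n → ℂ) l * W k j = γ l * y l j := by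
    have h : ∑ k : K, A l k * W k j
        - γ l * ∑ i, A l i * embedRows J0 hJ0 (Matrix.of Z) i j = 0 := congrFun hu (some (l, j))
    rw [hAX] at h
    simpa only [hAK] using sub_eq_zero.1 h
  have hcomb (j : Fin N) : ((∑ k, W k j • a k : V) : Fin n → ℂ) = fun l => γ l * y l j := by
    funext l
    rw [← heq]
    simp [mul_comm]
  have hγ' : γ = 0 := by
    funext l
    refine (hγ γ (fun i j => ?_) l l₀).trans hγ₀
    exact (hV _).1 (hcomb j ▸ Subtype.prop (∑ k, W k j • a k)) i
  have hW : W = 0 := by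
    funext k j
    refine Fintype.linearIndependent_iff.1 ha (fun k => W k j) (Subtype.ext ?_) k
    rw [hcomb, hγ']
    funext l
    simp
  rw [hγ', hW]
  rfl

/-- BGPC with a joint sparsity constraint: if `n > 2s` and `(n-1)/(n-2s) ≤ N ≤ s ≤ m`, then for
almost all `(λ₀, A, Z)`, with `X₀` the matrix supported on rows `J₀` filled with `Z`, the pair
`(λ₀, X₀)` is identifiable up to scaling over jointly `s`-sparse matrices. -/
theorem stmt1 {n m N s : ℕ} (hn : 0 < n) (hm : 0 < m) (hN : 0 < N) (hs : 0 < s)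
    (h2s : 2 * s < n) (hsc : n - 1 ≤ N * (n - 2 * s)) (hNs : N ≤ s) (hsm : s ≤ m)
    (J0 : Finset (Fin m)) (hJ0 : J0.card = s) :
    ∀ᵐ t : (Fin n → ℂ) × (Fin n → Fin m → ℂ) × (Fin s → Fin N → ℂ) ∂volume,
      ∀ (lam1 : Fin n → ℂ) (X1 : Matrix (Fin m) (Fin N) ℂ), JointSparse s X1 →
        Matrix.diagonal lam1 * Matrix.of t.2.1 * X1
          = Matrix.diagonal t.1 * Matrix.of t.2.1 * embedRows J0 hJ0 (Matrix.of t.2.2) →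
        ∃ σ : ℂ, σ ≠ 0 ∧ lam1 = σ⁻¹ • t.1 ∧ X1 = σ • embedRows J0 hJ0 (Matrix.of t.2.2) := by
  classical
  have : (volume : Measure (Fin n → Fin m → ℂ)).IsAddHaarMeasure :=
    Measure.pi.isAddHaarMeasure fun _ => volume
  have : (volume : Measure (Fin s → Fin N → ℂ)).IsAddHaarMeasure :=
    Measure.pi.isAddHaarMeasure fun _ => volume
  have : (volume : Measure ((Fin n → Fin m → ℂ) × (Fin s → Fin N → ℂ))).IsAddHaarMeasure :=
    Measure.prod.instIsAddHaarMeasure _ _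
  have : (volume : Measure ((Fin n → ℂ) × (Fin n → Fin m → ℂ) ×
      (Fin s → Fin N → ℂ))).IsAddHaarMeasure := Measure.prod.instIsAddHaarMeasure _ _
  have hnonzero : ∀ᵐ t : (Fin n → ℂ) × (Fin n → Fin m → ℂ) × (Fin s → Fin N → ℂ) ∂volume,
      ∏ l, t.1 l ≠ 0 :=
    ae_ne_zero_of_contDiff_omega volume (b := (1, 0, 0))
      (contDiff_prod fun l _ => by fun_prop) (by simp)
  let l₀ : Fin n := ⟨0, hn⟩
  have hinj : ∀ᵐ t : (Fin n → ℂ) × (Fin n → Fin m → ℂ) × (Fin s → Fin N → ℂ) ∂volume,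
      ∀ K : Finset (Fin m), J0 ⊆ K → K.card ≤ 2 * s →
        Function.Injective (calibrationMap J0 hJ0 K l₀ t) := by
    refine ae_all_iff.2 fun K => ?_
    by_cases hK : J0 ⊆ K ∧ K.card ≤ 2 * s
    · have hcard : n - 1 ≤ (n - K.card) * N := by
        rw [mul_comm]
        exact hsc.trans (Nat.mul_le_mul_left _ (by omega))
      filter_upwards [ae_injective_of_exists_injective volume (calibrationMap J0 hJ0 K l₀)
        (contDiff_calibrationMap J0 hJ0 K l₀) (exists_injective_calibrationMap hN hNs J0 hJ0 K
          hK.1 (by omega) hcard l₀)] with t ht _ _ using ht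
    · exact Filter.Eventually.of_forall fun t h₁ h₂ => absurd ⟨h₁, h₂⟩ hK
  filter_upwards [hnonzero, hinj] with t ht hinj lam1 X1 hX1 heq
  obtain ⟨lam0, A, Z⟩ := t
  simp only at ht heq ⊢
  have hlam0 (l : Fin n) : lam0 l ≠ 0 := Finset.prod_ne_zero_iff.1 ht l (Finset.mem_univ l)
  set X0 := embedRows J0 hJ0 (Matrix.of Z) with hX0
  let K : Finset (Fin m) := J0 ∪ {i | X1 i ≠ 0}.toFinset
  have hKcard : K.card ≤ 2 * s := by
    have h : {i : Fin m | X1 i ≠ 0}.toFinset.card ≤ s := by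
      rw [← Set.ncard_eq_toFinset_card']
      exact hX1
    have hunion : K.card ≤ J0.card + {i : Fin m | X1 i ≠ 0}.toFinset.card :=
      Finset.card_union_le _ _
    omega
  have hX1K (i : Fin m) (hi : i ∉ K) : X1 i = 0 := by
    by_contra h
    exact hi (by simp [K, h])
  have hX0K (i : Fin m) (hi : i ∉ K) (j : Fin N) : X0 i j = 0 := by
    have : i ∉ J0 := fun h => hi (Finset.mem_union_left _ h)
    simp [hX0, embedRows, this]
  have hker (γ : Fin n → ℂ) (W : Matrix (Fin m) (Fin N) ℂ) (hWK : ∀ i ∉ K, ∀ j, W i j = 0)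
      (hγ : γ l₀ = 0) (hγW : ∀ l j, ∑ i, A l i * W i j = γ l * ∑ i, A l i * X0 i j) :
      γ = 0 ∧ W = 0 := by
    have h : ((γ, fun (k : K) j => W k j) : (Fin n → ℂ) × (K → Fin N → ℂ)) = 0 := by
      refine (injective_iff_map_eq_zero _).1 (hinj K Finset.subset_union_left hKcard) _ ?_
      funext o
      cases o with
      | none => exact hγ
      | some p =>
        refine sub_eq_zero.2 ((?_ : _ = _).trans (hγW p.1 p.2))
        rw [Finset.sum_coe_sort K fun i => A p.1 i * W i p.2]
        refine Finset.sum_subset (Finset.subset_univ K) fun i _ hi => ?_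
        rw [hWK i hi, mul_zero]
    refine ⟨congrArg Prod.fst h, ?_⟩
    ext i j
    by_cases hi : i ∈ K
    · exact congrFun (congrFun (congrArg Prod.snd h) ⟨i, hi⟩) j
    · exact hWK i hi j
  have hentry (l : Fin n) (j : Fin N) :
      lam1 l * ∑ i, A l i * X1 i j = lam0 l * ∑ i, A l i * X0 i j := by
    have h := congrFun (congrFun heq l) j
    rw [Matrix.mul_assoc, Matrix.mul_assoc, Matrix.diagonal_mul, Matrix.diagonal_mul] at h
    simpa only [Matrix.mul_apply, Matrix.of_apply] using h
  have hlam1 (l : Fin n) : lam1 l ≠ 0 := by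
    intro hl
    have hrow (j : Fin N) : ∑ i, A l i * X0 i j = 0 := by
      have h := hentry l j
      rw [hl, zero_mul] at h
      exact (mul_eq_zero.1 h.symm).resolve_left (hlam0 l)
    let δ : Fin n → ℂ := Pi.single l 1
    obtain ⟨hδ, -⟩ := hker (fun l' => δ l' - δ l₀) (-δ l₀ • X0)
      (fun i hi j => by simp [hX0K i hi j]) (sub_self _) (fun l' j => by
        have hδX : δ l' * ∑ i, A l' i * X0 i j = 0 := by
          by_cases h : l' = l
          · rw [h, hrow, mul_zero]
          · simp [δ, h]
        rw [sub_mul, hδX, zero_sub, ← neg_mul, Finset.mul_sum]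
        exact Finset.sum_congr rfl fun i _ => by simp [mul_left_comm])
    have hconst (l' : Fin n) : δ l' = δ l₀ := sub_eq_zero.1 (congrFun hδ l')
    have : Nontrivial (Fin n) := Fin.nontrivial_iff_two_le.2 (by omega)
    obtain ⟨l', hl'⟩ := exists_ne l
    have h := (hconst l).trans (hconst l').symm
    simp [δ, hl'] at h
  let γ : Fin n → ℂ := fun l => lam0 l / lam1 l
  have hγ (l : Fin n) (j : Fin N) : ∑ i, A l i * X1 i j = γ l * ∑ i, A l i * X0 i j := by
    simp only [γ]
    rw [div_mul_eq_mul_div, eq_div_iff (hlam1 l), ← hentry, mul_comm]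
  obtain ⟨hγ₀, hW₀⟩ := hker (fun l => γ l - γ l₀) (X1 - γ l₀ • X0)
    (fun i hi j => by simp [hX1K i hi, hX0K i hi j]) (sub_self _) (fun l j => by
      simp only [Matrix.sub_apply, Matrix.smul_apply, smul_eq_mul, mul_sub, sub_mul,
        Finset.sum_sub_distrib, hγ, Finset.mul_sum]
      congr 1
      exact Finset.sum_congr rfl fun i _ => by ring)
  refine ⟨γ l₀, div_ne_zero (hlam0 l₀) (hlam1 l₀), ?_, sub_eq_zero.1 hW₀⟩
  funext l
  have h : γ l = γ l₀ := sub_eq_zero.1 (congrFun hγ₀ l)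
  rw [← h]
  simp only [γ, Pi.smul_apply, smul_eq_mul]
  field_simp [hlam0 l, hlam1 l]
end
end

section
/- Let A ∈ ℂ^{n×m}, Ω ⊆ ℂ^{m×N}, and (λ₀, X₀) ∈ ℂⁿ × Ω with λ₀ ≠ 0 and X₀ ≠ 0. Then (λ₀, X₀) is identifiable up to scaling if and only if the following two conditions both hold: (1) every (λ₁, X₁) ∈ ℂⁿ × Ω with diag(λ₁)·A·X₁ = diag(λ₀)·A·X₀ satisfies X₁ = σ·X₀ for some nonzero σ ∈ ℂ; (2) every λ₁ ∈ ℂⁿ with diag(λ₁)·A·X₀ = diag(λ₀)·A·X₀ satisfies λ₁ = λ₀. -/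
open Matrix

/-- Lemma 2.1 (equivalent conditions for identifiability up to scaling in BGPC):
`(λ₀, X₀)` with `λ₀ ≠ 0`, `X₀ ≠ 0` is identifiable up to scaling iff
(1) every compatible `(λ₁, X₁)` has `X₁ = σ X₀` for some `σ ≠ 0`, and
(2) every `λ₁` with `diag(λ₁) A X₀ = diag(λ₀) A X₀` equals `λ₀`. -/
theorem stmt2 {n m N : ℕ} (A : Matrix (Fin n) (Fin m) ℂ)
    (Ω : Set (Matrix (Fin m) (Fin N) ℂ))
    (lam0 : Fin n → ℂ) (X0 : Matrix (Fin m) (Fin N) ℂ)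
    (hlam0 : lam0 ≠ 0) (hX0 : X0 ≠ 0) (hX0Ω : X0 ∈ Ω) :
    (∀ (lam1 : Fin n → ℂ) (X1 : Matrix (Fin m) (Fin N) ℂ), X1 ∈ Ω →
        Matrix.diagonal lam1 * A * X1 = Matrix.diagonal lam0 * A * X0 →
        ∃ σ : ℂ, σ ≠ 0 ∧ lam1 = σ⁻¹ • lam0 ∧ X1 = σ • X0)
      ↔ ((∀ (lam1 : Fin n → ℂ) (X1 : Matrix (Fin m) (Fin N) ℂ), X1 ∈ Ω →
            Matrix.diagonal lam1 * A * X1 = Matrix.diagonal lam0 * A * X0 →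
            ∃ σ : ℂ, σ ≠ 0 ∧ X1 = σ • X0)
          ∧ (∀ lam1 : Fin n → ℂ,
            Matrix.diagonal lam1 * A * X0 = Matrix.diagonal lam0 * A * X0 →
            lam1 = lam0)) := by
  constructor
  · intro h
    refine ⟨fun lam1 X1 hX1 heq => ?_, fun lam1 heq => ?_⟩
    · obtain ⟨σ, hσ, -, hX⟩ := h lam1 X1 hX1 heq
      exact ⟨σ, hσ, hX⟩
    · obtain ⟨σ, -, hlam, hX⟩ := h lam1 X0 hX0Ω heq
      have hσ : σ = 1 := smul_left_injective ℂ hX0 (by simpa using hX.symm)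
      simpa [hσ] using hlam
  · rintro ⟨h₁, h₂⟩ lam1 X1 hX1 heq
    obtain ⟨σ, hσ, rfl⟩ := h₁ lam1 X1 hX1 heq
    have hlam : σ • lam1 = lam0 := h₂ _ (by
      rw [← heq, Matrix.diagonal_smul, Matrix.smul_mul, Matrix.smul_mul, Matrix.mul_smul])
    exact ⟨σ, hσ, by rw [← hlam, inv_smul_smul₀ hσ], rfl⟩
end

section
/- Let n, m, N be positive integers with n > m, N·(n−m) ≥ n−1, and N ≤ m. Then for almost all pairs (A, X₀) ∈ ℂ^{n×m} × ℂ^{m×N}, the matrix M(A, X₀) ∈ ℂ^{(1+n(N−1))×mN} has full column rank mN. -/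
open MeasureTheory Matrix

noncomputable section

/-- The `(N-1) × N` matrix `B(a,X)`: for `j = 0,…,N-2` (0-indexed), entry `(j,0)` is
`-(a · X^{(:,j+1)})`, entry `(j,j+1)` is `a · X^{(:,0)}`, all other entries zero. -/
def Bmat {m N : ℕ} (a : Fin m → ℂ) (X : Matrix (Fin m) (Fin N) ℂ) :
    Matrix (Fin (N - 1)) (Fin N) ℂ :=
  Matrix.of fun j k =>
    if (k : ℕ) = 0 then
      -(a ⬝ᵥ fun i => X i ⟨(j : ℕ) + 1, by have := j.isLt; omega⟩)
    else if (k : ℕ) = (j : ℕ) + 1 then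
      a ⬝ᵥ fun i => X i ⟨0, by have := j.isLt; omega⟩
    else 0

/-- Column-wise vectorization of `X`, indexed by (column, row). -/
def vecM {m N : ℕ} (X : Matrix (Fin m) (Fin N) ℂ) : Fin N × Fin m → ℂ :=
  fun p => X p.2 p.1

/-- `D(a,X) = B(a,X) ⊗ a`, an `(N-1) × mN` matrix, columns indexed compatibly with `vecM`. -/
def Dsmall {m N : ℕ} (a : Fin m → ℂ) (X : Matrix (Fin m) (Fin N) ℂ) :
    Matrix (Fin (N - 1)) (Fin N × Fin m) ℂ :=
  Matrix.of fun j p => Bmat a X j p.1 * a p.2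

/-- `D(A,X)`: vertical stack of `D(A^{(k,:)},X)` over the rows `k` of `A`. -/
def Dbig {n m N : ℕ} (A : Matrix (Fin n) (Fin m) ℂ) (X : Matrix (Fin m) (Fin N) ℂ) :
    Matrix (Fin n × Fin (N - 1)) (Fin N × Fin m) ℂ :=
  Matrix.of fun q p => Dsmall (A q.1) X q.2 p

/-- `M(A,X)`: the row `vec(X)^*` stacked on top of `D(A,X)`. -/
def Mmat {n m N : ℕ} (A : Matrix (Fin n) (Fin m) ℂ) (X : Matrix (Fin m) (Fin N) ℂ) :
    Matrix (Unit ⊕ Fin n × Fin (N - 1)) (Fin N × Fin m) ℂ :=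
  Matrix.of fun q p =>
    match q with
    | Sum.inl _ => star (vecM X p)
    | Sum.inr r => Dbig A X r p

open scoped ContDiff ComplexOrder

/-- A real-analytic function on a finite-dimensional real space that is nonzero somewhere is
nonzero almost everywhere. -/
theorem ae_ne_zero_of_analytic {E F : Type*} [NormedAddCommGroup E] [NormedSpace ℝ E]
    [FiniteDimensional ℝ E] [MeasurableSpace E] [BorelSpace E]
    (μ : Measure E) [μ.IsAddHaarMeasure] [NormedAddCommGroup F] [NormedSpace ℝ F]
    {f : E → F} (hf : ContDiff ℝ ω f) {t₀ : E} (h₀ : f t₀ ≠ 0) : ∀ᵐ t ∂μ, f t ≠ 0 := by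
  have line : ∀ v : E, ∀ᵐ s : ℝ, f (t₀ + s • v) ≠ 0 := by
    intro v
    have hline : ContDiff ℝ ω fun s : ℝ => f (t₀ + s • v) := hf.comp (by fun_prop)
    have hcod := AnalyticOnNhd.preimage_zero_mem_codiscrete (x := (0 : ℝ))
      (hline.analyticOnNhd (s := Set.univ)) (by simpa using h₀)
    have := ae_restrict_le_codiscreteWithin (μ := (volume : Measure ℝ)) MeasurableSet.univ hcod
    rw [Measure.restrict_univ] at this
    exact this
  have hcont : Continuous fun p : E × ℝ => f (t₀ + p.2 • p.1) :=
    hf.continuous.comp (by fun_prop)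
  have hmeas : MeasurableSet {p : E × ℝ | f (t₀ + p.2 • p.1) ≠ 0} :=
    (isOpen_ne_fun hcont continuous_const).measurableSet
  have swapped : ∀ᵐ s : ℝ, ∀ᵐ v ∂μ, f (t₀ + s • v) ≠ 0 :=
    (Measure.ae_ae_comm hmeas).1 (Filter.Eventually.of_forall line)
  obtain ⟨s, hs, hs0⟩ := (swapped.and (volume.ae_ne (0 : ℝ))).exists
  have hscaled : μ ((s • ·) ⁻¹' {w | f (t₀ + w) = 0}) = 0 := by
    simpa [ae_iff] using hs
  rw [Measure.addHaar_preimage_smul μ hs0, mul_eq_zero] at hscaled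
  have hzero : μ {w | f (t₀ + w) = 0} = 0 := by
    refine hscaled.resolve_left ?_
    simp [hs0]
  have htrans := measure_preimage_add μ t₀ {t | f t = 0}
  have : μ {t | f t = 0} = 0 := by rw [← htrans]; exact hzero
  simpa [ae_iff] using this

theorem Dbig_mulVec {n m N : ℕ} (hN : 0 < N) (A : Matrix (Fin n) (Fin m) ℂ)
    (X : Matrix (Fin m) (Fin N) ℂ) (v : Fin N × Fin m → ℂ) (k : Fin n) (j : Fin (N - 1))
    (c : Fin N) (hc : (c : ℕ) = j + 1) :
    (Dbig A X *ᵥ v) (k, j) =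
      (∑ i, A k i * X i ⟨0, hN⟩) * (∑ i, A k i * v (c, i))
        - (∑ i, A k i * X i c) * (∑ i, A k i * v (⟨0, hN⟩, i)) := by
  have hB : ∀ d : Fin N, Bmat (A k) X j d =
      (if d = c then ∑ i, A k i * X i ⟨0, hN⟩ else 0)
        + (if d = ⟨0, hN⟩ then -∑ i, A k i * X i c else 0) := by
    intro d
    obtain rfl : (⟨(j : ℕ) + 1, Nat.add_lt_of_lt_sub j.isLt⟩ : Fin N) = c := Fin.ext hc.symm
    simp only [Bmat, Matrix.of_apply, dotProduct, Fin.ext_iff]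
    split_ifs with h1 h2 h2 <;> first | omega | simp
  calc (Dbig A X *ᵥ v) (k, j)
      = ∑ d, Bmat (A k) X j d * ∑ i, A k i * v (d, i) := by
        simp only [mulVec, dotProduct, Dbig, Dsmall, Matrix.of_apply, Fintype.sum_prod_type,
          Finset.mul_sum, mul_assoc]
    _ = _ := by
        simp only [hB, add_mul, Finset.sum_add_distrib, ite_mul, zero_mul, Finset.sum_ite_eq',
          Finset.mem_univ, if_true]
        ring

/-- The kernel of `D(A,X)` consists of the `Y` whose products `a · Y` are, for each row `a` of `A`,
proportional to `a · X`. -/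
theorem Dbig_mulVec_eq_zero_iff {n m N : ℕ} (hN : 0 < N) (A : Matrix (Fin n) (Fin m) ℂ)
    (X : Matrix (Fin m) (Fin N) ℂ) (v : Fin N × Fin m → ℂ) :
    Dbig A X *ᵥ v = 0 ↔ ∀ k c,
      (∑ i, A k i * X i ⟨0, hN⟩) * (∑ i, A k i * v (c, i))
        = (∑ i, A k i * X i c) * (∑ i, A k i * v (⟨0, hN⟩, i)) := by
  constructor
  · intro h k c
    by_cases hc : (c : ℕ) = 0
    · have : c = ⟨0, hN⟩ := Fin.ext hc
      rw [this]
    · have hj := Dbig_mulVec hN A X v k ⟨c - 1, by omega⟩ c (by simp; omega)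
      rw [h] at hj
      exact sub_eq_zero.1 hj.symm
  · rintro h
    ext ⟨k, j⟩
    rw [Dbig_mulVec hN A X v k j ⟨j + 1, by omega⟩ rfl]
    exact sub_eq_zero.2 (h k _)

theorem Dbig_mulVec_vecM {n m N : ℕ} (hN : 0 < N) (A : Matrix (Fin n) (Fin m) ℂ)
    (X : Matrix (Fin m) (Fin N) ℂ) : Dbig A X *ᵥ vecM X = 0 :=
  (Dbig_mulVec_eq_zero_iff hN A X _).2 fun _ _ => mul_comm _ _

/-- The matrix `D(A,X)` below a row reading off the coordinate `z`. -/
def DbigWithCoord {n m N : ℕ} (z : Fin N × Fin m) (A : Matrix (Fin n) (Fin m) ℂ)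
    (X : Matrix (Fin m) (Fin N) ℂ) : Matrix (Unit ⊕ Fin n × Fin (N - 1)) (Fin N × Fin m) ℂ :=
  Matrix.fromRows (Matrix.of fun _ => Pi.single z 1) (Dbig A X)

theorem DbigWithCoord_mulVec_eq_zero_iff {n m N : ℕ} (z : Fin N × Fin m)
    (A : Matrix (Fin n) (Fin m) ℂ) (X : Matrix (Fin m) (Fin N) ℂ) (v : Fin N × Fin m → ℂ) :
    DbigWithCoord z A X *ᵥ v = 0 ↔ v z = 0 ∧ Dbig A X *ᵥ v = 0 := by
  rw [DbigWithCoord, fromRows_mulVec]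
  constructor
  · intro h
    refine ⟨?_, funext fun r => congrFun h (Sum.inr r)⟩
    simpa [mulVec] using congrFun h (Sum.inl ())
  · rintro ⟨h1, h2⟩
    ext (q | q)
    · simpa [mulVec] using h1
    · exact congrFun h2 q

/-- A pair `(A, X)` for which the kernel of `D(A,X)` is a line. -/
theorem exists_kernel_line {n m N : ℕ} (hm : 0 < m) (hN : 0 < N)
    (hmn : m < n) (hsc : n - 1 ≤ N * (n - m)) :
    ∃ (A : Fin n → Fin m → ℂ) (X : Fin m → Fin N → ℂ), X ⟨0, hm⟩ ⟨0, hN⟩ ≠ 0 ∧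
      ∀ v : Fin N × Fin m → ℂ, DbigWithCoord (⟨0, hN⟩, ⟨0, hm⟩) (Matrix.of A) (Matrix.of X) *ᵥ v = 0 → v = 0 := by
  have hcap : m - 1 ≤ (N - 1) * (n - m) := by
    have : (N - 1) * (n - m) = N * (n - m) - (n - m) := by rw [Nat.sub_mul, one_mul]
    omega
  have hpos : ∀ i : Fin m, i ≠ ⟨0, hm⟩ → 0 < N - 1 ∧ (i : ℕ) - 1 < (N - 1) * (n - m) := by
    intro i hi
    have hi' : (i : ℕ) ≠ 0 := fun h => hi (Fin.ext h)
    have hlt : (i : ℕ) - 1 < (N - 1) * (n - m) := by omega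
    exact ⟨Nat.pos_of_ne_zero fun h => by simp [h] at hlt, hlt⟩
  -- the indices `i ≠ 0` are placed at distinct cells `(g i, h i)` of an `(n-m) × (N-1)` grid
  let g : Fin m → ℕ := fun i => m + ((i : ℕ) - 1) / (N - 1)
  let h : Fin m → ℕ := fun i => 1 + ((i : ℕ) - 1) % (N - 1)
  have hg : ∀ i, i ≠ ⟨0, hm⟩ → g i < n := by
    intro i hi
    have := Nat.div_lt_of_lt_mul (hpos i hi).2
    simp only [g]; omega
  have hh : ∀ i, i ≠ ⟨0, hm⟩ → h i < N := by
    intro i hi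
    have := Nat.mod_lt ((i : ℕ) - 1) (hpos i hi).1
    simp only [h]; omega
  have hinj : ∀ i i', i ≠ ⟨0, hm⟩ → i' ≠ ⟨0, hm⟩ → g i = g i' → h i = h i' → i = i' := by
    intro i i' hi hi' hgg hhh
    have h1 : ((i : ℕ) - 1) / (N - 1) = ((i' : ℕ) - 1) / (N - 1) := by simp only [g] at hgg; omega
    have h2 : ((i : ℕ) - 1) % (N - 1) = ((i' : ℕ) - 1) % (N - 1) := by simp only [h] at hhh; omega
    have h3 := Nat.div_add_mod ((i : ℕ) - 1) (N - 1)
    rw [h1, h2, Nat.div_add_mod] at h3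
    have hi0 : (i : ℕ) ≠ 0 := fun h => hi (Fin.ext h)
    have hi0' : (i' : ℕ) ≠ 0 := fun h => hi' (Fin.ext h)
    exact Fin.ext (by omega)
  let A : Matrix (Fin n) (Fin m) ℂ := Matrix.of fun k i =>
    if (k : ℕ) < m then (if (i : ℕ) = k then 1 else 0)
    else (if i = ⟨0, hm⟩ then 1 else 0) + (if i ≠ ⟨0, hm⟩ ∧ g i = k then 1 else 0)
  let X : Matrix (Fin m) (Fin N) ℂ := Matrix.of fun i c =>
    (if c = ⟨0, hN⟩ then 1 else 0) + (if i ≠ ⟨0, hm⟩ ∧ h i = c then 1 else 0)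
  have hX0 : ∀ i, X i ⟨0, hN⟩ = 1 := by
    intro i
    simp [X, h]
  have hXc : ∀ (i : Fin m) (c : Fin N), (c : ℕ) ≠ 0 → X i c = if i ≠ ⟨0, hm⟩ ∧ h i = c then 1 else 0 := by
    intro i c hc
    simp [X, Fin.ext_iff, hc]
  have hAlow : ∀ (i : Fin m) (w : Fin m → ℂ), ∑ l, A ⟨i, by omega⟩ l * w l = w i := by
    intro i w
    simp [A, ← Fin.ext_iff]
  have hAhigh : ∀ (k : Fin n) (w : Fin m → ℂ), m ≤ (k : ℕ) → ∑ l, A k l * w l =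
      w ⟨0, hm⟩ + ∑ l with l ≠ ⟨0, hm⟩ ∧ g l = k, w l := by
    intro k w hk
    simp only [A, Matrix.of_apply, if_neg (not_lt.2 hk), add_mul, Finset.sum_add_distrib,
      ite_mul, one_mul, zero_mul, Finset.sum_ite_eq', Finset.mem_univ, if_true,
      Finset.sum_filter]
  refine ⟨A, X, by rw [hX0]; exact one_ne_zero, fun v hv => ?_⟩
  obtain ⟨hv0, hker⟩ := (DbigWithCoord_mulVec_eq_zero_iff _ _ _ _).1 hv
  replace hker : ∀ k c,
      (∑ i, A k i * X i ⟨0, hN⟩) * (∑ i, A k i * v (c, i))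
        = (∑ i, A k i * X i c) * (∑ i, A k i * v (⟨0, hN⟩, i)) :=
    (Dbig_mulVec_eq_zero_iff hN _ _ _).1 hker
  have hrow : ∀ i c, v (c, i) = X i c * v (⟨0, hN⟩, i) := by
    intro i c
    have := hker ⟨i, by omega⟩ c
    rwa [hAlow i fun l => X l ⟨0, hN⟩, hAlow i fun l => v (c, l), hAlow i fun l => X l c,
      hAlow i fun l => v (⟨0, hN⟩, l), hX0, one_mul] at this
  suffices hcol : ∀ i, v (⟨0, hN⟩, i) = 0 by
    ext ⟨c, i⟩
    rw [hrow, hcol, mul_zero, Pi.zero_apply]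
  have hgroup : ∀ i₀ : Fin m, i₀ ≠ ⟨0, hm⟩ →
      (1 + (Finset.card {l : Fin m | l ≠ ⟨0, hm⟩ ∧ g l = g i₀} : ℂ)) * v (⟨0, hN⟩, i₀)
        = ∑ l with l ≠ ⟨0, hm⟩ ∧ g l = g i₀, v (⟨0, hN⟩, l) := by
    intro i₀ hi₀
    have hcell : ∀ w : Fin m → ℂ, ∑ l with l ≠ ⟨0, hm⟩ ∧ g l = g i₀,
        X l ⟨h i₀, hh i₀ hi₀⟩ * w l = w i₀ := by
      intro w
      have hh0 : h i₀ ≠ 0 := by simp [h]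
      rw [Finset.sum_eq_single i₀]
      · rw [hXc _ _ hh0, if_pos ⟨hi₀, rfl⟩, one_mul]
      · intro l hl hne
        simp only [Finset.mem_filter, Finset.mem_univ, true_and] at hl
        rw [hXc _ _ hh0, if_neg, zero_mul]
        exact fun hx => hne (hinj _ _ hl.1 hi₀ hl.2 hx.2)
      · intro hn
        simp [hi₀] at hn
    have hX00 : X ⟨0, hm⟩ ⟨h i₀, hh i₀ hi₀⟩ = 0 := by
      rw [hXc _ _ (by simp [h])]; simp
    have key := hker ⟨g i₀, hg i₀ hi₀⟩ ⟨h i₀, hh i₀ hi₀⟩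
    have hmk : m ≤ ((⟨g i₀, hg i₀ hi₀⟩ : Fin n) : ℕ) := by simp [g]
    rw [hAhigh _ (fun l => X l ⟨0, hN⟩) hmk, hAhigh _ (fun l => v (⟨h i₀, hh i₀ hi₀⟩, l)) hmk,
      hAhigh _ (fun l => X l ⟨h i₀, hh i₀ hi₀⟩) hmk, hAhigh _ (fun l => v (⟨0, hN⟩, l)) hmk] at key
    simp only [hrow _ ⟨h i₀, hh i₀ hi₀⟩, hX0, hX00, hv0, zero_mul, zero_add, hcell] at key
    have hone := hcell fun _ => 1
    simp only [mul_one] at hone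
    rw [hone, one_mul] at key
    simpa using key
  intro i₀
  by_cases hi₀ : i₀ = ⟨0, hm⟩
  · rw [hi₀]; exact hv0
  have hsum : ∑ l with l ≠ ⟨0, hm⟩ ∧ g l = g i₀, v (⟨0, hN⟩, l) = 0 := by
    have hall : ∀ i ∈ ({l : Fin m | l ≠ ⟨0, hm⟩ ∧ g l = g i₀} : Finset (Fin m)),
        (1 + (Finset.card {l : Fin m | l ≠ ⟨0, hm⟩ ∧ g l = g i₀} : ℂ)) * v (⟨0, hN⟩, i)
          = ∑ l with l ≠ ⟨0, hm⟩ ∧ g l = g i₀, v (⟨0, hN⟩, l) := by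
      intro i hi
      simp only [Finset.mem_filter, Finset.mem_univ, true_and] at hi
      have := hgroup i hi.1
      rwa [hi.2] at this
    have := Finset.sum_congr rfl hall
    rw [← Finset.mul_sum, Finset.sum_const, nsmul_eq_mul] at this
    linear_combination this
  have hne : (1 + (Finset.card {l : Fin m | l ≠ ⟨0, hm⟩ ∧ g l = g i₀} : ℂ)) ≠ 0 := by
    rw [add_comm]; exact Nat.cast_add_one_ne_zero _
  have := hgroup i₀ hi₀
  rw [hsum] at this
  exact (mul_eq_zero.1 this).resolve_left hne

theorem Mmat_rank_of_kernel_line {n m N : ℕ} (hN : 0 < N) (z : Fin N × Fin m)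
    (A : Matrix (Fin n) (Fin m) ℂ) (X : Matrix (Fin m) (Fin N) ℂ) (hX : X z.2 z.1 ≠ 0)
    (hker : ∀ v, DbigWithCoord z A X *ᵥ v = 0 → v = 0) : (Mmat A X).rank = m * N := by
  have hinj : Function.Injective (Mmat A X).mulVecLin := by
    refine (injective_iff_map_eq_zero _).2 fun v hv => ?_
    rw [Matrix.mulVecLin_apply] at hv
    have hD : Dbig A X *ᵥ v = 0 := funext fun r => congrFun hv (Sum.inr r)
    have hstar : star (vecM X) ⬝ᵥ v = 0 := congrFun hv (Sum.inl ())
    have hXz : vecM X z ≠ 0 := hX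
    have hline : v = (v z / vecM X z) • vecM X := by
      refine sub_eq_zero.1 (hker _ ((DbigWithCoord_mulVec_eq_zero_iff _ _ _ _).2 ⟨?_, ?_⟩))
      · simp [hXz]
      · rw [mulVec_sub, mulVec_smul, hD, Dbig_mulVec_vecM hN, smul_zero, sub_zero]
    rw [hline, dotProduct_smul, smul_eq_mul, mul_eq_zero] at hstar
    rcases hstar with h | h
    · rw [hline, h, zero_smul]
    · exact absurd (congrFun (dotProduct_star_self_eq_zero.1 h) z) hXz
  rw [Matrix.rank, LinearMap.finrank_range_of_inj hinj]
  simp [mul_comm]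

theorem contDiff_DbigWithCoord {n m N : ℕ} (z : Fin N × Fin m)
    (q : Unit ⊕ Fin n × Fin (N - 1)) (p : Fin N × Fin m) :
    ContDiff ℝ ω fun t : (Fin n → Fin m → ℂ) × (Fin m → Fin N → ℂ) =>
      DbigWithCoord z (Matrix.of t.1) (Matrix.of t.2) q p := by
  have hA : ∀ k i, ContDiff ℝ ω fun t : (Fin n → Fin m → ℂ) × (Fin m → Fin N → ℂ) => t.1 k i :=
    fun k i => by fun_prop
  have hX : ∀ i c, ContDiff ℝ ω fun t : (Fin n → Fin m → ℂ) × (Fin m → Fin N → ℂ) => t.2 i c :=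
    fun i c => by fun_prop
  have hAX : ∀ k c, ContDiff ℝ ω fun t : (Fin n → Fin m → ℂ) × (Fin m → Fin N → ℂ) =>
      ∑ i, t.1 k i * t.2 i c :=
    fun k c => ContDiff.sum fun i _ => (hA k i).mul (hX i c)
  rcases q with q | ⟨k, j⟩
  · exact contDiff_const
  · change ContDiff ℝ ω fun t : (Fin n → Fin m → ℂ) × (Fin m → Fin N → ℂ) =>
      (if (p.1 : ℕ) = 0 then _ else if (p.1 : ℕ) = (j : ℕ) + 1 then _ else 0) * t.1 k p.2
    refine ContDiff.mul ?_ (hA k p.2)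
    split_ifs
    · exact (hAX k _).neg
    · exact hAX k _
    · exact contDiff_const

/-- Claim 3.2: for `n > m` and `(n-1)/(n-m) ≤ N ≤ m`, the matrix `M(A, X₀)` has full column
rank `mN` for almost all `(A, X₀)`. -/
theorem stmt3 {n m N : ℕ} (hn : 0 < n) (hm : 0 < m) (hN : 0 < N)
    (hmn : m < n) (hsc : n - 1 ≤ N * (n - m)) (hNm : N ≤ m) :
    ∀ᵐ t : (Fin n → Fin m → ℂ) × (Fin m → Fin N → ℂ) ∂volume,
      (Mmat (Matrix.of t.1) (Matrix.of t.2)).rank = m * N := by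
  obtain ⟨A₀, X₀, hX₀, hinj₀⟩ := exists_kernel_line hm hN hmn hsc
  set z : Fin N × Fin m := (⟨0, hN⟩, ⟨0, hm⟩)
  let f : (Fin n → Fin m → ℂ) × (Fin m → Fin N → ℂ) → ℂ := fun t =>
    ((DbigWithCoord z (Matrix.of A₀) (Matrix.of X₀))ᴴ *
      DbigWithCoord z (Matrix.of t.1) (Matrix.of t.2)).det * t.2 z.2 z.1
  have hf : ContDiff ℝ ω f := by
    refine ContDiff.mul ?_ (by fun_prop)
    simp only [det_apply', mul_apply]
    exact ContDiff.sum fun σ _ => contDiff_const.mul (contDiff_prod fun p _ =>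
      ContDiff.sum fun q _ => contDiff_const.mul (contDiff_DbigWithCoord z q p))
  have hf₀ : f (A₀, X₀) ≠ 0 := by
    refine mul_ne_zero (fun hdet => ?_) hX₀
    obtain ⟨v, hv, hv0⟩ := exists_mulVec_eq_zero_iff.2 hdet
    exact hv (hinj₀ v ((conjTranspose_mul_self_mulVec_eq_zero _ _).1 hv0))
  have hHaarPi : ∀ p q : ℕ, (volume : Measure (Fin p → Fin q → ℂ)).IsAddHaarMeasure := fun p q =>
    Measure.pi.isAddHaarMeasure fun _ : Fin p => (volume : Measure (Fin q → ℂ))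
  have hHaar : (volume : Measure ((Fin n → Fin m → ℂ) × (Fin m → Fin N → ℂ))).IsAddHaarMeasure :=
    Measure.prod.instIsAddHaarMeasure volume volume
  filter_upwards [ae_ne_zero_of_analytic volume hf hf₀] with t ht
  refine Mmat_rank_of_kernel_line hN z _ _ (right_ne_zero_of_mul ht) fun v hv => ?_
  by_contra hv0
  refine left_ne_zero_of_mul ht (exists_mulVec_eq_zero_iff.1 ⟨v, hv0, ?_⟩)
  rw [← mulVec_mulVec, hv, mulVec_zero]
end
end

section
/- Let n, m, N be integers with n > m ≥ N ≥ 2. Let C ⊆ {N+1,…,n} with |C| = n−m, N+1 ∈ C, n ∈ C, and such that any two consecutive elements of C (in increasing order) differ by at most N. Let S = {1,…,n} ∖ C, enumerated increasingly as s₁ < s₂ < … < s_m (so s_j = j for j = 1,…,N). Define A ∈ ℂ^{n×m} by A^{(k,j)} = F_n^{(k,s_j)}, and let X₀ ∈ ℂ^{m×N} consist of the first N columns of the m×m identity matrix. Then the matrix D(A, X₀) ∈ ℂ^{n(N−1)×mN} has rank exactly mN−1. -/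
open MeasureTheory Matrix

noncomputable section

/-- The `(j,k)` entry (1-indexed) of the `n × n` DFT matrix `F_n`:
`ω^{(j-1)(k-1)}` with `ω = exp(-2πi/n)`. -/
def Fent (n j k : ℕ) : ℂ :=
  Complex.exp (-2 * Real.pi * Complex.I * (((j - 1) * (k - 1) : ℕ) : ℂ) / n)

/-- Fourier inversion: the power sums of a weighted family of `n`-th roots of unity determine the
total weight at each `n`-th root of unity. -/
lemma sum_power_sums_mul_inv_pow {ι : Type*} [Fintype ι] {n : ℕ} (hn : n ≠ 0) {x : ι → ℂ}
    (hx : ∀ i, x i ^ n = 1) (f : ι → ℂ) {w : ℂ} (hw : w ^ n = 1) :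
    ∑ k : Fin n, (∑ i, f i * x i ^ (k : ℕ)) * (w ^ (k : ℕ))⁻¹ =
      n * ∑ i, if x i = w then f i else 0 := by
  have hw0 : w ≠ 0 := by
    rintro rfl
    simp [hn] at hw
  have orth : ∀ z : ℂ, z ^ n = 1 →
      ∑ k : Fin n, z ^ (k : ℕ) * (w ^ (k : ℕ))⁻¹ = if z = w then (n : ℂ) else 0 := by
    intro z hz
    split_ifs with hzw
    · subst hzw
      simp [hw0]
    · have h1 : z * w⁻¹ - 1 ≠ 0 := by
        intro h0
        apply hzw
        field_simp at h0
        linear_combination h0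
      have h2 := mul_geom_sum (z * w⁻¹) n
      rw [mul_pow, inv_pow, hz, hw] at h2
      have h3 : ∑ k ∈ Finset.range n, (z * w⁻¹) ^ k = 0 := by
        simpa [h1] using h2
      rw [Fin.sum_univ_eq_sum_range (fun k => z ^ k * (w ^ k)⁻¹), ← h3]
      simp [mul_pow]
  simp_rw [Finset.sum_mul, Finset.mul_sum]
  rw [Finset.sum_comm]
  refine Finset.sum_congr rfl fun i _ => ?_
  simp_rw [mul_assoc]
  rw [← Finset.mul_sum, orth _ (hx i)]
  split_ifs <;> ring

/-- Power sums of two weighted families of `n`-th roots of unity that agree for all exponents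
`k < n` have the same total weight at every `n`-th root of unity. -/
lemma sum_weight_eq_of_power_sums_eq {ι κ : Type*} [Fintype ι] [Fintype κ] {n : ℕ} (hn : n ≠ 0)
    {x : ι → ℂ} {y : κ → ℂ} (hx : ∀ i, x i ^ n = 1) (hy : ∀ i, y i ^ n = 1) (f : ι → ℂ) (g : κ → ℂ)
    (h : ∀ k : Fin n, ∑ i, f i * x i ^ (k : ℕ) = ∑ i, g i * y i ^ (k : ℕ))
    {w : ℂ} (hw : w ^ n = 1) :
    (∑ i, if x i = w then f i else 0) = ∑ i, if y i = w then g i else 0 := by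
  have hn' : (n : ℂ) ≠ 0 := by exact_mod_cast hn
  apply mul_left_cancel₀ hn'
  rw [← sum_power_sums_mul_inv_pow hn hx f hw, ← sum_power_sums_mul_inv_pow hn hy g hw]
  simp_rw [h]

/-- If `C` contains `N + 1` and `n`, and adjacent elements of `C` differ by at most `N`, then every
window of length `N` starting in `[2, n]` meets `C`. -/
lemma exists_mem_window {n N : ℕ} {C : Finset ℕ} (hmem1 : N + 1 ∈ C) (hmemn : n ∈ C)
    (hgap : ∀ c ∈ C, ∀ c' ∈ C, c < c' → (∀ x ∈ C, ¬(c < x ∧ x < c')) → c' ≤ c + N)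
    {t : ℕ} (ht : 2 ≤ t) (htn : t ≤ n) : ∃ c ∈ C, t ≤ c ∧ c < t + N := by
  rcases le_or_gt t (N + 1) with h | h
  · exact ⟨N + 1, hmem1, h, by omega⟩
  have hlo : (C.filter (· < t)).Nonempty := ⟨N + 1, by simp [hmem1, h]⟩
  have hhi : (C.filter (t ≤ ·)).Nonempty := ⟨n, by simp [hmemn, htn]⟩
  obtain ⟨hc, hct⟩ := Finset.mem_filter.mp (Finset.max'_mem _ hlo)
  obtain ⟨hd, htd⟩ := Finset.mem_filter.mp (Finset.min'_mem _ hhi)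
  refine ⟨_, hd, htd, ?_⟩
  have := hgap _ hc _ hd (lt_of_lt_of_le hct htd) ?_
  · omega
  · rintro x hx ⟨h1, h2⟩
    rcases lt_or_ge x t with h3 | h3
    · exact absurd h1 (Finset.le_max' _ x (by simp [hx, h3])).not_gt
    · exact absurd h2 (Finset.min'_le _ x (by simp [hx, h3])).not_gt

/-- A strictly increasing sequence of positive integers whose range contains `1, …, N` starts with
`1, …, N`. -/
lemma strictMono_eq_succ_of_mem_range {m N : ℕ} {s : Fin m → ℕ} (hs : StrictMono s)
    (hpos : ∀ i, 1 ≤ s i) (hrange : ∀ t, 1 ≤ t → t ≤ N → ∃ i, s i = t) :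
    ∀ i : Fin m, (i : ℕ) < N → s i = i + 1 := by
  have hle : ∀ k (hk : k < m), k + 1 ≤ s ⟨k, hk⟩ := by
    intro k
    induction k with
    | zero => exact fun hk => hpos _
    | succ k ih =>
      intro hk
      have h1 := ih (by omega)
      have h2 : s ⟨k, by omega⟩ < s ⟨k + 1, hk⟩ := hs (by simp [Fin.lt_def])
      omega
  have key : ∀ k (hk : k < m), k < N → s ⟨k, hk⟩ = k + 1 := by
    intro k
    induction k using Nat.strong_induction_on with
    | _ k ih =>
      intro hk hkN
      obtain ⟨j, hj⟩ := hrange (k + 1) (by omega) (by omega)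
      have h1 := hle j j.isLt
      have h2 : (j : ℕ) = k := by
        by_contra hne
        have := ih j (by simp only [Fin.eta] at h1; omega) j.isLt
          (by simp only [Fin.eta] at h1; omega)
        simp only [Fin.eta] at this
        omega
      subst h2
      exact hj
  exact fun i hi => key i i.isLt hi

lemma Fent_succ_eq_pow {n : ℕ} (k s : ℕ) :
    Fent n (k + 1) s = (Complex.exp (2 * Real.pi * Complex.I / n))⁻¹ ^ ((s - 1) * k) := by
  rw [Fent, ← Complex.exp_neg, ← Complex.exp_nat_mul]
  congr 1
  push_cast [Nat.add_sub_cancel]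
  ring

/-- When the columns of `X` are the first `N` standard basis vectors, the rows of `D(A, X) v`
involve only the first `N` entries of the rows of `A` and the pairings with the blocks of `v`. -/
lemma Dbig_mulVec_apply {n m N : ℕ} (hNm : N ≤ m) (A : Matrix (Fin n) (Fin m) ℂ)
    (v : Fin N × Fin m → ℂ) (k : Fin n) (j : Fin (N - 1)) (o l : Fin N) (ho : (o : ℕ) = 0)
    (hl : (l : ℕ) = j + 1) :
    (Dbig A (Matrix.of fun (i : Fin m) (j : Fin N) => if (i : ℕ) = (j : ℕ) then (1 : ℂ) else 0) *ᵥ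
        v) (k, j) =
      -A k (Fin.castLE hNm l) * (∑ i, A k i * v (o, i)) +
        A k (Fin.castLE hNm o) * ∑ i, A k i * v (l, i) := by
  have hdot : ∀ p : Fin N, (A k ⬝ᵥ fun i : Fin m => if (i : ℕ) = (p : ℕ) then (1 : ℂ) else 0) =
      A k (Fin.castLE hNm p) := by
    intro p
    rw [dotProduct, Finset.sum_eq_single (Fin.castLE hNm p)]
    · simp
    · intro b _ hb
      simp [show (b : ℕ) ≠ p from fun h => hb (Fin.ext h)]
    · simp
  have hB : ∀ q, Bmat (A k) (Matrix.of fun (i : Fin m) (j : Fin N) =>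
      if (i : ℕ) = (j : ℕ) then (1 : ℂ) else 0) j q =
      (if q = o then -A k (Fin.castLE hNm l) else 0) +
        if q = l then A k (Fin.castLE hNm o) else 0 := by
    intro q
    have h1 := hdot ⟨j + 1, by omega⟩
    have h2 := hdot ⟨0, by omega⟩
    have e1 : ⟨j + 1, by omega⟩ = l := Fin.ext hl.symm
    have e2 : ⟨0, by omega⟩ = o := Fin.ext ho.symm
    simp only [Bmat, Matrix.of_apply]
    simp only [e1, e2] at h1 h2
    rw [h1, h2]
    simp only [Fin.ext_iff, ho, hl]
    split_ifs <;> first | omega | simp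
  simp only [mulVec, dotProduct, Dbig, Dsmall, Matrix.of_apply, Fintype.sum_prod_type, hB]
  simp only [add_mul, ite_mul, zero_mul, Finset.sum_add_distrib, Finset.mul_sum]
  congr 1
  · rw [Finset.sum_eq_single o] <;> simp +contextual [mul_assoc]
  · rw [Finset.sum_eq_single l] <;> simp +contextual [mul_assoc]

/-- For the explicit construction where the columns of `A` are the columns of `F_n` indexed by
`S = {1,…,n} ∖ C` (with `C ⊆ {N+1,…,n}`, `|C| = n-m`, `N+1 ∈ C`, `n ∈ C`, adjacent elements of
`C` differing by at most `N`) and `X₀` consists of the first `N` columns of `I_m`,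
the matrix `D(A, X₀)` has rank exactly `mN - 1`. -/
theorem stmt9 {n m N : ℕ} (hN : 2 ≤ N) (hNm : N ≤ m) (hmn : m < n)
    (C : Finset ℕ) (hCsub : C ⊆ Finset.Icc (N + 1) n) (hCcard : C.card = n - m)
    (hmem1 : N + 1 ∈ C) (hmemn : n ∈ C)
    (hgap : ∀ c ∈ C, ∀ c' ∈ C, c < c' → (∀ x ∈ C, ¬(c < x ∧ x < c')) → c' ≤ c + N)
    (hS : (Finset.Icc 1 n \ C).card = m) :
    (Dbig
        (Matrix.of fun (k : Fin n) (j : Fin m) =>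
          Fent n ((k : ℕ) + 1) (((Finset.Icc 1 n \ C).orderIsoOfFin hS j : ℕ)))
        (Matrix.of fun (i : Fin m) (j : Fin N) =>
          if (i : ℕ) = (j : ℕ) then (1 : ℂ) else 0)).rank = m * N - 1 := by
  have hn : n ≠ 0 := by omega
  set s : Fin m → ℕ := fun j => ((Finset.Icc 1 n \ C).orderIsoOfFin hS j : ℕ)
  have hs : StrictMono s := fun i j hij =>
    ((Finset.Icc 1 n \ C).orderIsoOfFin hS).strictMono hij
  have hmem : ∀ i, (1 ≤ s i ∧ s i ≤ n) ∧ s i ∉ C := fun i => by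
    have h : s i ∈ Finset.Icc 1 n \ C := ((Finset.Icc 1 n \ C).orderIsoOfFin hS i).2
    rwa [Finset.mem_sdiff, Finset.mem_Icc] at h
  have hsurj : ∀ t, 1 ≤ t → t ≤ n → t ∉ C → ∃ i, s i = t := fun t h1 h2 h3 =>
    ⟨((Finset.Icc 1 n \ C).orderIsoOfFin hS).symm ⟨t, by simp [h1, h2, h3]⟩, by
      simp only [s, OrderIso.apply_symm_apply]⟩
  have hfirst : ∀ i : Fin m, (i : ℕ) < N → s i = i + 1 :=
    strictMono_eq_succ_of_mem_range hs (fun i => (hmem i).1.1) fun t h1 h2 =>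
      hsurj t h1 (by omega) fun hc => by
        have := Finset.mem_Icc.mp (hCsub hc)
        omega
  set ω : ℂ := (Complex.exp (2 * Real.pi * Complex.I / n))⁻¹
  have hω : IsPrimitiveRoot ω n := (Complex.isPrimitiveRoot_exp n hn).inv
  have hω0 : ω ≠ 0 := hω.ne_zero hn
  have hroot : ∀ t : ℕ, (ω ^ t) ^ n = 1 := fun t => by
    rw [pow_right_comm, hω.pow_eq_one, one_pow]
  have hinj : ∀ {t : ℕ}, t < n → ∀ i, ω ^ (s i - 1) = ω ^ t ↔ s i = t + 1 := by
    intro t ht i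
    have := hmem i
    constructor
    · intro h
      have := hω.pow_inj (by omega) ht h
      omega
    · intro h
      rw [h, Nat.add_sub_cancel]
  set A : Matrix (Fin n) (Fin m) ℂ :=
    Matrix.of fun (k : Fin n) (j : Fin m) => Fent n ((k : ℕ) + 1) (s j)
  have hA : ∀ k j, A k j = (ω ^ (s j - 1)) ^ (k : ℕ) := fun k j => by
    rw [← pow_mul]
    exact Fent_succ_eq_pow k (s j)
  set X : Matrix (Fin m) (Fin N) ℂ :=
    Matrix.of fun (i : Fin m) (j : Fin N) => if (i : ℕ) = (j : ℕ) then (1 : ℂ) else 0 with hX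
  let o : Fin N := ⟨0, by omega⟩
  have hApow : ∀ k (l : Fin N), A k (Fin.castLE hNm l) = (ω ^ (l : ℕ)) ^ (k : ℕ) := fun k l => by
    rw [hA, hfirst _ l.isLt]
    simp
  have hker : LinearMap.ker (Dbig A X).mulVecLin = Submodule.span ℂ {vecM X} := by
    apply le_antisymm
    · intro v hv
      rw [LinearMap.mem_ker, Matrix.mulVecLin_apply] at hv
      have hshift : ∀ (k : Fin n) (l : Fin N),
          ∑ i, v (l, i) * (ω ^ (s i - 1)) ^ (k : ℕ) =
            ∑ i, v (o, i) * (ω ^ (s i - 1 + l)) ^ (k : ℕ) := by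
        intro k l
        rcases Nat.eq_zero_or_pos (l : ℕ) with h0 | h0
        · rw [show l = o from Fin.ext h0]
          simp [o]
        · have h1 := congrFun hv (k, ⟨l - 1, by omega⟩)
          rw [hX, Dbig_mulVec_apply hNm A v k _ o l rfl (by simp; omega), hApow, hApow] at h1
          simp only [hA, o, pow_zero, one_pow, one_mul, Pi.zero_apply] at h1
          simp_rw [pow_add, mul_pow]
          calc _ = (ω ^ (l : ℕ)) ^ (k : ℕ) * ∑ i, (ω ^ (s i - 1)) ^ (k : ℕ) * v (o, i) := by
                simp_rw [mul_comm (v _)]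
                linear_combination h1
            _ = _ := by
                rw [Finset.mul_sum]
                exact Finset.sum_congr rfl fun i _ => by ring
      have hcoeff : ∀ (l : Fin N) (t : ℕ),
          (∑ i, if ω ^ (s i - 1) = ω ^ t then v (l, i) else 0) =
            ∑ i, if ω ^ (s i - 1 + l) = ω ^ t then v (o, i) else 0 := fun l t =>
        sum_weight_eq_of_power_sums_eq hn (fun _ => hroot _) (fun _ => hroot _) _ _
          (fun k => hshift k l) (hroot t)
      have hvanish : ∀ i, 2 ≤ s i → v (o, i) = 0 := by
        intro i hi
        obtain ⟨c, hc, hic, hcN⟩ := exists_mem_window hmem1 hmemn hgap hi (hmem i).1.2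
        have hcn := (Finset.mem_Icc.mp (hCsub hc)).2
        have h1 := hcoeff ⟨c - s i, by omega⟩ (s i - 1 + (c - s i))
        rw [Finset.sum_eq_zero, Finset.sum_eq_single i] at h1
        · simpa using h1.symm
        · intro b _ hb
          rw [if_neg]
          intro h
          simp only [pow_add] at h
          have h2 := mul_right_cancel₀ (pow_ne_zero _ hω0) h
          have h3 := hmem i
          rw [hinj (by omega)] at h2
          exact hb (hs.injective (by omega))
        · simp
        · intro b _
          rw [if_neg]
          intro h
          rw [hinj (by omega)] at h
          exact (hmem b).2 (by rwa [h, show s i - 1 + (c - s i) + 1 = c by omega])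
      rw [Submodule.mem_span_singleton]
      refine ⟨v (o, Fin.castLE hNm o), ?_⟩
      ext ⟨l, i⟩
      have hi := hmem i
      have h1 := hcoeff l (s i - 1)
      rw [Finset.sum_eq_single i, Finset.sum_eq_single (Fin.castLE hNm o), if_pos rfl,
        hfirst _ o.isLt] at h1
      · have h2 : ω ^ (l : ℕ) = ω ^ (s i - 1) ↔ (i : ℕ) = l := by
          have := hfirst (Fin.castLE hNm l) l.isLt
          rw [eq_comm, hinj (by omega)]
          constructor
          · intro h
            simpa using congrArg Fin.val (hs.injective (h.trans this.symm))
          · intro h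
            rw [show i = Fin.castLE hNm l from Fin.ext h, this, Fin.val_castLE]
        rw [h1]
        simp [vecM, X, o, h2]
      · intro b _ hb
        rw [hvanish b, ite_self]
        have h3 := hs (show Fin.castLE hNm o < b from
          lt_of_le_of_ne (by simp [Fin.le_def, o]) hb.symm)
        have h4 := hmem (Fin.castLE hNm o)
        omega
      · simp
      · intro b _ hb
        rw [if_neg]
        intro h
        rw [hinj (by omega)] at h
        exact hb (hs.injective (by omega))
      · simp
    · rw [Submodule.span_singleton_le_iff_mem, LinearMap.mem_ker, Matrix.mulVecLin_apply]
      ext ⟨k, j⟩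
      have hsum : ∀ l : Fin N, ∑ i, A k i * vecM X (l, i) = A k (Fin.castLE hNm l) := by
        intro l
        rw [Finset.sum_eq_single (Fin.castLE hNm l)]
        · simp [vecM, X]
        · intro b _ hb
          simp [vecM, X, show (b : ℕ) ≠ l from fun h => hb (Fin.ext h)]
        · simp
      rw [hX, Dbig_mulVec_apply hNm A _ k j o ⟨j + 1, by omega⟩ rfl rfl, ← hX, hsum, hsum,
        Pi.zero_apply]
      ring
  have hne : vecM X ≠ 0 := fun h => by
    have := congrFun h (o, Fin.castLE hNm o)
    simp [vecM, X] at this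
  have hrank := LinearMap.finrank_range_add_finrank_ker (Dbig A X).mulVecLin
  rw [hker, finrank_span_singleton hne, Module.finrank_fintype_fun_eq_card, Fintype.card_prod,
    Fintype.card_fin, Fintype.card_fin] at hrank
  rw [Matrix.rank, mul_comm m N]
  omega
end
end

section
/- Let λ₀ ∈ ℂⁿ have all entries nonzero, let A ∈ ℂ^{n×m} and X₀ ∈ ℂ^{m×N} with N ≥ 2. Suppose that every row of A·X₀ is nonzero and that the matrix M(A, X₀) ∈ ℂ^{(1+n(N−1))×mN} has full column rank mN. Then (λ₀, X₀) is identifiable up to scaling with constraint set Ω = ℂ^{m×N}: every (λ₁, X₁) ∈ ℂⁿ × ℂ^{m×N} with diag(λ₁)·A·X₁ = diag(λ₀)·A·X₀ satisfies λ₁ = σ⁻¹·λ₀ and X₁ = σ·X₀ for some nonzero σ ∈ ℂ. -/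
open MeasureTheory Matrix

noncomputable section

theorem Mmat_mulVec_inl {n m N : ℕ} (A : Matrix (Fin n) (Fin m) ℂ)
    (X : Matrix (Fin m) (Fin N) ℂ) (v : Fin N × Fin m → ℂ) (u : Unit) :
    (Mmat A X *ᵥ v) (Sum.inl u) = star (vecM X) ⬝ᵥ v := rfl

/-- The lower block of `M(A,X) vec(Y)` consists of 2×2 minors formed from the rows of
`A * X` and `A * Y`. -/
theorem Mmat_mulVec_vecM_inr {n m N : ℕ} (A : Matrix (Fin n) (Fin m) ℂ)
    (X Y : Matrix (Fin m) (Fin (N + 1)) ℂ) (k : Fin n) (j : Fin N) :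
    (Mmat A X *ᵥ vecM Y) (Sum.inr (k, j)) =
      (A * X) k 0 * (A * Y) k j.succ - (A * X) k j.succ * (A * Y) k 0 := by
  have hB : (Mmat A X *ᵥ vecM Y) (Sum.inr (k, j)) =
      ∑ l, Bmat (A k) X j l * (A * Y) k l := by
    simp only [Mmat, Dbig, Dsmall, vecM, mulVec, dotProduct, Matrix.of_apply, Matrix.mul_apply,
      Fintype.sum_prod_type, Finset.mul_sum, mul_assoc]
  have h0 : Bmat (A k) X j 0 = -(A * X) k j.succ := rfl
  have hs : ∀ l : Fin N, Bmat (A k) X j l.succ = if l = j then (A * X) k 0 else 0 := by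
    intro l
    simp only [Bmat, Matrix.of_apply, Fin.val_succ, Nat.succ_ne_zero, if_false,
      add_left_inj, Fin.ext_iff]
    rfl
  rw [hB, Fin.sum_univ_succ, h0]
  simp only [hs, ite_mul, zero_mul, Finset.sum_ite_eq', Finset.mem_univ, if_true]
  ring

theorem Matrix.mulVec_injective_of_rank_eq_card {m n K : Type*} [Fintype n] [Field K]
    (M : Matrix m n K) (h : M.rank = Fintype.card n) : Function.Injective M.mulVec := by
  have := M.mulVecLin.finrank_range_add_finrank_ker
  rw [Module.finrank_fintype_fun_eq_card, ← h, Matrix.rank] at this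
  have hker : Module.finrank K (LinearMap.ker M.mulVecLin) = 0 := by omega
  exact LinearMap.ker_eq_bot.mp (Submodule.finrank_eq_zero.mp hker)

/-- If all entries of `λ₀` are nonzero, every row of `A·X₀` is nonzero, and `M(A,X₀)` has
full column rank `mN`, then `(λ₀, X₀)` is identifiable up to scaling (subspace constraint). -/
theorem stmt11 {n m N : ℕ} (hN : 2 ≤ N)
    (lam0 : Fin n → ℂ) (hlam0 : ∀ k, lam0 k ≠ 0)
    (A : Matrix (Fin n) (Fin m) ℂ) (X0 : Matrix (Fin m) (Fin N) ℂ)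
    (hrows : ∀ k : Fin n, (A * X0) k ≠ 0)
    (hrank : (Mmat A X0).rank = m * N) :
    ∀ (lam1 : Fin n → ℂ) (X1 : Matrix (Fin m) (Fin N) ℂ),
      Matrix.diagonal lam1 * A * X1 = Matrix.diagonal lam0 * A * X0 →
      ∃ σ : ℂ, σ ≠ 0 ∧ lam1 = σ⁻¹ • lam0 ∧ X1 = σ • X0 := by
  intro lam1 X1 h
  rcases Nat.eq_zero_or_pos n with rfl | hn
  · have hle := (Mmat A X0).rank_le_card_height
    rw [hrank] at hle
    simp only [Fintype.card_sum, Fintype.card_prod, Fintype.card_fin, Fintype.card_unit,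
      zero_mul, add_zero] at hle
    obtain rfl : m = 0 := by
      by_contra hm
      nlinarith [Nat.pos_of_ne_zero hm]
    exact ⟨1, one_ne_zero, Subsingleton.elim _ _, Subsingleton.elim _ _⟩
  obtain ⟨N, rfl⟩ : ∃ N', N = N' + 1 := ⟨N - 1, by omega⟩
  have hinj := (Mmat A X0).mulVec_injective_of_rank_eq_card (by
    rw [hrank, Fintype.card_prod, Fintype.card_fin, Fintype.card_fin, mul_comm])
  have hent : ∀ k j, lam1 k * (A * X1) k j = lam0 k * (A * X0) k j := fun k j => by
    simpa [Matrix.mul_assoc, Matrix.diagonal_mul] using congrFun (congrFun h k) j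
  have hlam1 : ∀ k, lam1 k ≠ 0 := fun k hk => hrows k <| funext fun j => by
    simpa [hk, hlam0 k] using (hent k j).symm
  have hX0 : vecM X0 ≠ 0 := fun h0 => hrows ⟨0, hn⟩ <| by
    have : X0 = 0 := by
      ext i j
      exact congrFun h0 (j, i)
    simp [this]
    rfl
  have hnorm : star (vecM X0) ⬝ᵥ vecM X0 ≠ 0 := by
    open scoped ComplexOrder in exact fun h0 => hX0 (dotProduct_star_self_eq_zero.mp h0)
  set c : ℂ := (star (vecM X0) ⬝ᵥ vecM X1) / (star (vecM X0) ⬝ᵥ vecM X0) with hc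
  have hvec : vecM X1 = c • vecM X0 := by
    apply hinj
    rw [Matrix.mulVec_smul]
    ext (u | ⟨k, j⟩)
    · rw [Pi.smul_apply, Mmat_mulVec_inl, Mmat_mulVec_inl, smul_eq_mul, hc,
        div_mul_cancel₀ _ hnorm]
    · rw [Pi.smul_apply, Mmat_mulVec_vecM_inr A X0 X1 k j, Mmat_mulVec_vecM_inr A X0 X0 k j,
        mul_comm ((A * X0) k 0) ((A * X0) k (Fin.succ j)), sub_self, smul_zero]
      apply mul_left_cancel₀ (hlam1 k)
      linear_combination (A * X0) k 0 * hent k (Fin.succ j) - (A * X0) k (Fin.succ j) * hent k 0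
  have hX1 : X1 = c • X0 := by
    ext i j
    exact congrFun hvec (j, i)
  have hscale : ∀ k, lam1 k * c = lam0 k := fun k => by
    obtain ⟨j, hj⟩ := Function.ne_iff.mp (hrows k)
    apply mul_right_cancel₀ hj
    simpa [hX1, mul_assoc] using hent k j
  have hc0 : c ≠ 0 := right_ne_zero_of_mul (hscale ⟨0, hn⟩ ▸ hlam0 ⟨0, hn⟩)
  refine ⟨c, hc0, funext fun k => ?_, hX1⟩
  rw [Pi.smul_apply, smul_eq_mul, ← hscale k]
  field_simp
end
end

section
/- Let n ≥ N+1 and N ≥ 2 be integers, and let C ⊆ {N+1,…,n} be a set with N+1 ∈ C, n ∈ C, and such that any two consecutive elements of C (in increasing order) differ by at most N. Then {c − j : c ∈ C, 0 ≤ j ≤ N−1} = {2, 3, …, n}. -/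
/-- If `C ⊆ {N+1,…,n}` contains `N+1` and `n` and any two adjacent elements of `C` differ by
at most `N`, then `{c - j : c ∈ C, 0 ≤ j ≤ N-1} = {2,…,n}`. -/
theorem stmt13 {n N : ℕ} (hN : 2 ≤ N) (hn : N + 1 ≤ n) (C : Finset ℕ)
    (hCsub : C ⊆ Finset.Icc (N + 1) n) (hmem1 : N + 1 ∈ C) (hmemn : n ∈ C)
    (hgap : ∀ c ∈ C, ∀ c' ∈ C, c < c' → (∀ x ∈ C, ¬(c < x ∧ x < c')) → c' ≤ c + N) :
    Finset.image (fun p : ℕ × ℕ => p.1 - p.2) (C ×ˢ Finset.range N) = Finset.Icc 2 n := by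
  ext x
  simp only [Finset.mem_image, Finset.mem_product, Finset.mem_range, Finset.mem_Icc, Prod.exists]
  constructor
  · rintro ⟨c, j, ⟨hc, hj⟩, rfl⟩
    have := Finset.mem_Icc.1 (hCsub hc)
    omega
  · rintro ⟨hx2, hxn⟩
    by_cases hx : x ≤ N + 1
    · exact ⟨N + 1, N + 1 - x, ⟨hmem1, by omega⟩, by omega⟩
    obtain ⟨c, hc, hcmax⟩ := (C.filter (· < x)).exists_max_image id
      ⟨N + 1, Finset.mem_filter.2 ⟨hmem1, by omega⟩⟩
    obtain ⟨c', hc', hcmin⟩ := (C.filter (x ≤ ·)).exists_min_image id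
      ⟨n, Finset.mem_filter.2 ⟨hmemn, hxn⟩⟩
    simp only [Finset.mem_filter, id, and_imp] at hc hcmax hc' hcmin
    have hcc' : c' ≤ c + N := by
      refine hgap c hc.1 c' hc'.1 (by omega) fun y hy hlt => ?_
      rcases lt_or_ge y x with h | h
      · have := hcmax y hy h
        omega
      · have := hcmin y hy h
        omega
    exact ⟨c', c' - x, ⟨hc'.1, by omega⟩, by omega⟩
end
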